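/- arXiv:1507.05229 — 2 statements merged into one kernel-verified Lean document; each statement's English description precedes it below -/
import Mathlib

section
/- Theorem 1.1, (iii) ⇒ (i): Let γ>0 and suppose there exists a γ-self-similar entrance law (η_t)_{t>0} for X such that η_1 is a probability measure. Then E[e^{γξ_1}, 1<ζ] ≤ 1. -/
open MeasureTheory Real Set Filter
open scoped ENNReal

noncomputable section

variable {Ω : Type*}

/-- The additive-functional "clock" `s ↦ ∫_0^s e^{α ξ_u} 1_{u<ζ} du` of Lamperti's
transformation. -/
def lampertiClock (α : ℝ) (ξ : ℝ → Ω → ℝ) (ζ : Ω → ℝ≥0∞) (ω : Ω) (s : ℝ) : ℝ≥0∞ :=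
  ∫⁻ u in Set.Ioo (0 : ℝ) s,
    {u : ℝ | ENNReal.ofReal u < ζ ω}.indicator (fun u => ENNReal.ofReal (Real.exp (α * ξ u ω))) u

/-- The exponential functional `I = ∫_0^ζ e^{α ξ_u} du` of the Lévy process `ξ`. -/
def expFunctional (α : ℝ) (ξ : ℝ → Ω → ℝ) (ζ : Ω → ℝ≥0∞) (ω : Ω) : ℝ≥0∞ :=
  ∫⁻ u in Set.Ioi (0 : ℝ),
    {u : ℝ | ENNReal.ofReal u < ζ ω}.indicator (fun u => ENNReal.ofReal (Real.exp (α * ξ u ω))) u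

/-- Lamperti's time change `τ(t) = inf{s > 0 : ∫_0^s e^{α ξ_u} du > t}`. -/
def lampertiTimeChange (α : ℝ) (ξ : ℝ → Ω → ℝ) (ζ : Ω → ℝ≥0∞) (ω : Ω) (t : ℝ) : ℝ :=
  sInf {s : ℝ | 0 < s ∧ ENNReal.ofReal t < lampertiClock α ξ ζ ω s}

/-- The sub-Markov semigroup `f ↦ E_x[f(X_t), t < T_0]` of the `1/α`-pssMp `X` obtained from the
(killed) Lévy process `ξ` through Lamperti's transformation:
`X_t = x e^{ξ_{τ(t x^{-α})}}` for `t < x^α I`, and `X_t = 0` (absorption) for `t ≥ x^α I`. -/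
def lampertiSemigroup [MeasurableSpace Ω] (α : ℝ) (ξ : ℝ → Ω → ℝ) (ζ : Ω → ℝ≥0∞)
    (P : Measure Ω) (t x : ℝ) : Measure ℝ :=
  Measure.map (fun ω => x * Real.exp (ξ (lampertiTimeChange α ξ ζ ω (t / x ^ α)) ω))
    (P.restrict {ω | ENNReal.ofReal (t / x ^ α) < expFunctional α ξ ζ ω})

/-- `ξ` is, under `P`, a real-valued Lévy process killed at the (independent exponential)
time `ζ` (sent to the cemetery `-∞`; `ζ = ∞` a.s. is allowed): joint measurability,
`ξ_0 = 0` a.s., and stationary independent increments on the event of survival. -/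
def IsKilledLevy [MeasurableSpace Ω] (P : Measure Ω) (ξ : ℝ → Ω → ℝ) (ζ : Ω → ℝ≥0∞) : Prop :=
  Measurable (Function.uncurry ξ) ∧ Measurable ζ ∧ (∀ᵐ ω ∂P, ξ 0 ω = 0) ∧
    ∀ s t : ℝ, 0 ≤ s → 0 ≤ t → ∀ g h : ℝ → ℝ≥0∞, Measurable g → Measurable h →
      ∫⁻ ω, {ω : Ω | ENNReal.ofReal (s + t) < ζ ω}.indicator
          (fun ω => g (ξ s ω) * h (ξ (s + t) ω - ξ s ω)) ω ∂P
        = (∫⁻ ω, {ω : Ω | ENNReal.ofReal s < ζ ω}.indicator (fun ω => g (ξ s ω)) ω ∂P)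
            * ∫⁻ ω, {ω : Ω | ENNReal.ofReal t < ζ ω}.indicator (fun ω => h (ξ t ω)) ω ∂P

/-- (EL-i): `(η_s)_{s>0}` is an entrance law for the (sub-Markov) semigroup `K`. -/
def IsEntranceLaw (K : ℝ → ℝ → Measure ℝ) (η : ℝ → Measure ℝ) : Prop :=
  ∀ s : ℝ, 0 < s → ∀ t : ℝ, 0 ≤ t → ∀ f : ℝ → ℝ≥0∞, Measurable f →
    ∫⁻ x, (∫⁻ y, f y ∂(K t x)) ∂(η s) = ∫⁻ y, f y ∂(η (t + s))

/-- `(η_s)_{s>0}` is a `γ`-self-similar entrance law (γ-ssel) for the killed semigroup `K` of a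
`1/α`-pssMp: a family of σ-finite measures on `(0,∞)` satisfying (EL-i) and the scaling
property (EL-ii): `η_s f = s^{-γ/α} η_1(f(s^{1/α}·))`. -/
def IsSSEL (α γ : ℝ) (K : ℝ → ℝ → Measure ℝ) (η : ℝ → Measure ℝ) : Prop :=
  (∀ s : ℝ, 0 < s → SigmaFinite (η s)) ∧
  (∀ s : ℝ, 0 < s → η s (Set.Iic 0) = 0) ∧
  IsEntranceLaw K η ∧
  ∀ s : ℝ, 0 < s → ∀ f : ℝ → ℝ≥0∞, Measurable f →
    ∫⁻ x, f x ∂(η s) = ENNReal.ofReal (s ^ (-(γ / α))) * ∫⁻ x, f (s ^ α⁻¹ * x) ∂(η 1)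

/-- The candidate `γ`-ssel: the measure with
`μ^γ_s f = s^{-γ/α} Ê^{(γ)}[ f((s/I)^{1/α}) I^{γ/α - 1} ]`, where `(P', ξ', ζ')` carries the
dual of the Esscher transform of index `γ` and `I = ∫_0^ζ e^{α ξ_u} du` under it. -/
def sselMeasure [MeasurableSpace Ω] (α γ : ℝ) (P' : Measure Ω) (ξ' : ℝ → Ω → ℝ)
    (ζ' : Ω → ℝ≥0∞) (s : ℝ) : Measure ℝ :=
  Measure.map (fun ω => (s / (expFunctional α ξ' ζ' ω).toReal) ^ α⁻¹)
    (P'.withDensity fun ω =>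
      ENNReal.ofReal (s ^ (-(γ / α)) * (expFunctional α ξ' ζ' ω).toReal ^ (γ / α - 1)))

/-- `(ξ', ζ', P')` realizes the law `P̂^{(γ)}` of the dual `-ξ` of the Esscher transform of
index `γ` of `(ξ, ζ, P)`: for every `t ≥ 0` and every `F_t`-measurable path functional `G`,
`Ê^{(γ)}[G(ξ̂), t < ζ̂] = E[e^{γ ξ_t} G(-ξ), t < ζ]`. -/
def IsEsscherDual [MeasurableSpace Ω] {Ω' : Type*} [MeasurableSpace Ω'] (γ : ℝ)
    (P : Measure Ω) (ξ : ℝ → Ω → ℝ) (ζ : Ω → ℝ≥0∞)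
    (P' : Measure Ω') (ξ' : ℝ → Ω' → ℝ) (ζ' : Ω' → ℝ≥0∞) : Prop :=
  ∀ t : ℝ, 0 ≤ t → ∀ G : (ℝ → ℝ) → ℝ≥0∞, Measurable G →
    (∀ p q : ℝ → ℝ, (∀ u, 0 ≤ u → u ≤ t → p u = q u) → G p = G q) →
    ∫⁻ ω, {ω : Ω' | ENNReal.ofReal t < ζ' ω}.indicator (fun ω => G fun u => ξ' u ω) ω ∂P'
      = ∫⁻ ω, {ω : Ω | ENNReal.ofReal t < ζ ω}.indicator
          (fun ω => ENNReal.ofReal (Real.exp (γ * ξ t ω)) * G fun u => -ξ u ω) ω ∂P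


/-- The law of `ξ_s` on the event of survival `{s < ζ}`. -/
def stateLaw [MeasurableSpace Ω] (P : Measure Ω) (ξ : ℝ → Ω → ℝ) (ζ : Ω → ℝ≥0∞) (s : ℝ) :
    Measure ℝ :=
  (P.restrict {ω | ENNReal.ofReal s < ζ ω}).map (ξ s)

section StateLaw

variable [MeasurableSpace Ω] {P : Measure Ω} {ξ : ℝ → Ω → ℝ} {ζ : Ω → ℝ≥0∞}

lemma measurableSet_alive (hζ : Measurable ζ) (s : ℝ) :
    MeasurableSet {ω : Ω | ENNReal.ofReal s < ζ ω} :=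
  measurableSet_lt measurable_const hζ

lemma measurableSet_alive_prod (hζ : Measurable ζ) :
    MeasurableSet {p : ℝ × Ω | ENNReal.ofReal p.1 < ζ p.2} :=
  measurableSet_lt (ENNReal.measurable_ofReal.comp measurable_fst) (hζ.comp measurable_snd)

lemma lintegral_stateLaw (hξ : Measurable (Function.uncurry ξ)) (hζ : Measurable ζ) (s : ℝ)
    {φ : ℝ → ℝ≥0∞} (hφ : Measurable φ) :
    ∫⁻ y, φ y ∂(stateLaw P ξ ζ s)
      = ∫⁻ ω, {ω : Ω | ENNReal.ofReal s < ζ ω}.indicator (fun ω => φ (ξ s ω)) ω ∂P := by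
  rw [stateLaw, lintegral_map hφ hξ.of_uncurry_left,
    lintegral_indicator (measurableSet_alive hζ s)]

instance [IsFiniteMeasure P] (s : ℝ) : IsFiniteMeasure (stateLaw P ξ ζ s) := by
  unfold stateLaw; infer_instance

lemma stateLaw_le_one [IsProbabilityMeasure P] (hξ : Measurable (Function.uncurry ξ))
    (s : ℝ) {B : Set ℝ} (hB : MeasurableSet B) :
    stateLaw P ξ ζ s B ≤ 1 := by
  rw [stateLaw, Measure.map_apply hξ.of_uncurry_left hB]
  exact (Measure.restrict_apply_le _ _).trans prob_le_one

lemma measurable_lintegral_stateLaw [SFinite P] (hξ : Measurable (Function.uncurry ξ))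
    (hζ : Measurable ζ) {β : Type*} [MeasurableSpace β] {φ : β → ℝ → ℝ≥0∞}
    (hφ : Measurable (Function.uncurry φ)) {σ : β → ℝ} (hσ : Measurable σ) :
    Measurable fun b => ∫⁻ y, φ b y ∂(stateLaw P ξ ζ (σ b)) := by
  have h : ∀ b, ∫⁻ y, φ b y ∂(stateLaw P ξ ζ (σ b)) = ∫⁻ ω,
      {p : β × Ω | ENNReal.ofReal (σ p.1) < ζ p.2}.indicator
        (fun p => φ p.1 (ξ (σ p.1) p.2)) (b, ω) ∂P := by
    intro b
    rw [lintegral_stateLaw hξ hζ _ hφ.of_uncurry_left]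
    rfl
  simp_rw [h]
  refine Measurable.lintegral_prod_right' (Measurable.indicator ?_ ?_)
  · exact hφ.comp (measurable_fst.prodMk
      (hξ.comp ((hσ.comp measurable_fst).prodMk measurable_snd)))
  · exact measurableSet_lt (ENNReal.measurable_ofReal.comp (hσ.comp measurable_fst))
      (hζ.comp measurable_snd)

lemma measurable_stateLaw_apply [SFinite P] (hξ : Measurable (Function.uncurry ξ))
    (hζ : Measurable ζ) {B : Set ℝ} (hB : MeasurableSet B) :
    Measurable fun s => stateLaw P ξ ζ s B := by
  have := measurable_lintegral_stateLaw (P := P) hξ hζ (β := ℝ)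
    (φ := fun _ y => B.indicator 1 y) ((measurable_one.indicator hB).comp measurable_snd)
    measurable_id
  simpa [lintegral_indicator_one hB] using this

/-- The Chapman–Kolmogorov relation for the laws of a killed Lévy process. -/
lemma lintegral_stateLaw_add [IsFiniteMeasure P] (hL : IsKilledLevy P ξ ζ) {s t : ℝ}
    (hs : 0 ≤ s) (ht : 0 ≤ t) {φ : ℝ → ℝ≥0∞} (hφ : Measurable φ) :
    ∫⁻ y, φ y ∂(stateLaw P ξ ζ (s + t))
      = ∫⁻ a, ∫⁻ b, φ (a + b) ∂(stateLaw P ξ ζ t) ∂(stateLaw P ξ ζ s) := by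
  obtain ⟨hξ, hζ, -, hinc⟩ := hL
  have hm : Measurable fun ω => (ξ s ω, ξ (s + t) ω - ξ s ω) :=
    hξ.of_uncurry_left.prodMk (hξ.of_uncurry_left.sub hξ.of_uncurry_left)
  have hprod : (stateLaw P ξ ζ s).prod (stateLaw P ξ ζ t)
      = (P.restrict {ω | ENNReal.ofReal (s + t) < ζ ω}).map
          (fun ω => (ξ s ω, ξ (s + t) ω - ξ s ω)) := by
    refine Measure.prod_eq fun A B hA hB => ?_
    have h := hinc s t hs ht (A.indicator 1) (B.indicator 1)
      (measurable_one.indicator hA) (measurable_one.indicator hB)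
    rw [← lintegral_stateLaw hξ hζ s (measurable_one.indicator hA),
      ← lintegral_stateLaw hξ hζ t (measurable_one.indicator hB),
      lintegral_indicator_one hA, lintegral_indicator_one hB,
      lintegral_indicator (measurableSet_alive hζ _)] at h
    rw [← h, Measure.map_apply hm (hA.prod hB), ← lintegral_indicator_one (hm (hA.prod hB))]
    refine lintegral_congr fun ω => ?_
    by_cases h1 : ξ s ω ∈ A <;> by_cases h2 : ξ (s + t) ω - ξ s ω ∈ B <;> simp [h1, h2]
  have hφ2 : Measurable fun p : ℝ × ℝ => φ (p.1 + p.2) := hφ.comp measurable_add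
  rw [lintegral_lintegral (f := fun a b => φ (a + b)) hφ2.aemeasurable, hprod,
    lintegral_map hφ2 hm, stateLaw, lintegral_map hφ hξ.of_uncurry_left]
  simp

end StateLaw

lemma sq_setLIntegral_le {β : Type*} [MeasurableSpace β] (μ : Measure β) {f : β → ℝ≥0∞}
    (hf : Measurable f) (E : Set β) :
    (∫⁻ x in E, f x ∂μ) ^ 2 ≤ μ E * ∫⁻ x, f x ^ 2 ∂μ := by
  have h := ENNReal.lintegral_mul_le_Lp_mul_Lq (μ.restrict E) Real.HolderConjugate.two_two
    hf.aemeasurable (aemeasurable_const (b := (1 : ℝ≥0∞)))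
  simp only [Pi.mul_apply, mul_one, ENNReal.one_rpow, lintegral_const, one_mul,
    Measure.restrict_apply_univ] at h
  have hsq : ∀ a : ℝ≥0∞, (a ^ (1 / 2 : ℝ)) ^ 2 = a := fun a => by
    rw [← ENNReal.rpow_natCast, ← ENNReal.rpow_mul]; norm_num
  calc (∫⁻ x in E, f x ∂μ) ^ 2
      ≤ ((∫⁻ x in E, f x ^ (2 : ℝ) ∂μ) ^ (1 / 2 : ℝ) * μ E ^ (1 / 2 : ℝ)) ^ 2 := by
        gcongr
    _ = (∫⁻ x in E, f x ^ 2 ∂μ) * μ E := by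
        rw [mul_pow, hsq, hsq]; simp only [ENNReal.rpow_ofNat]
    _ ≤ (∫⁻ x, f x ^ 2 ∂μ) * μ E := by gcongr; exact Measure.restrict_le_self
    _ = _ := mul_comm _ _

/-- The set of pairs `(s, ω)` for which `ξ` is alive and in `B` at time `s`. -/
def visitSet (ξ : ℝ → Ω → ℝ) (ζ : Ω → ℝ≥0∞) (B : Set ℝ) : Set (ℝ × Ω) :=
  {p | ENNReal.ofReal p.1 < ζ p.2 ∧ ξ p.1 p.2 ∈ B}

/-- The time spent in `B` by `ξ` during `[0, T)`. -/
def occupation (ξ : ℝ → Ω → ℝ) (ζ : Ω → ℝ≥0∞) (B : Set ℝ) (T : ℝ) (ω : Ω) : ℝ≥0∞ :=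
  ∫⁻ s in Ico (0 : ℝ) T, (visitSet ξ ζ B).indicator 1 (s, ω)

/-- The mean time spent in `B` during `[0, T)`. -/
def meanOccupation [MeasurableSpace Ω] (P : Measure Ω) (ξ : ℝ → Ω → ℝ) (ζ : Ω → ℝ≥0∞)
    (B : Set ℝ) (T : ℝ) : ℝ≥0∞ :=
  ∫⁻ s in Ico (0 : ℝ) T, stateLaw P ξ ζ s B

section Transience

variable [MeasurableSpace Ω] {P : Measure Ω} {ξ : ℝ → Ω → ℝ} {ζ : Ω → ℝ≥0∞}

lemma measurableSet_visitSet (hξ : Measurable (Function.uncurry ξ)) (hζ : Measurable ζ)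
    {B : Set ℝ} (hB : MeasurableSet B) : MeasurableSet (visitSet ξ ζ B) :=
  (measurableSet_alive_prod hζ).inter (hξ hB)

lemma measurable_visit (hξ : Measurable (Function.uncurry ξ)) (hζ : Measurable ζ)
    {B : Set ℝ} (hB : MeasurableSet B) :
    Measurable ((visitSet ξ ζ B).indicator (1 : ℝ × Ω → ℝ≥0∞)) :=
  measurable_one.indicator (measurableSet_visitSet hξ hζ hB)

lemma measurable_occupation (hξ : Measurable (Function.uncurry ξ)) (hζ : Measurable ζ)
    {B : Set ℝ} (hB : MeasurableSet B) (T : ℝ) : Measurable (occupation ξ ζ B T) :=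
  (measurable_visit hξ hζ hB).lintegral_prod_left'

lemma lintegral_visit (hξ : Measurable (Function.uncurry ξ)) (hζ : Measurable ζ)
    {B : Set ℝ} (hB : MeasurableSet B) (s : ℝ) :
    ∫⁻ ω, (visitSet ξ ζ B).indicator 1 (s, ω) ∂P = stateLaw P ξ ζ s B := by
  rw [← lintegral_indicator_one hB, lintegral_stateLaw hξ hζ s (measurable_one.indicator hB)]
  refine lintegral_congr fun ω => ?_
  by_cases h1 : ENNReal.ofReal s < ζ ω <;> by_cases h2 : ξ s ω ∈ B <;>
    simp [visitSet, h1, h2]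

lemma lintegral_occupation [SFinite P] (hξ : Measurable (Function.uncurry ξ))
    (hζ : Measurable ζ) {B : Set ℝ} (hB : MeasurableSet B) (T : ℝ) :
    ∫⁻ ω, occupation ξ ζ B T ω ∂P = meanOccupation P ξ ζ B T := by
  unfold occupation meanOccupation
  rw [lintegral_lintegral_swap (f := fun ω s => (visitSet ξ ζ B).indicator 1 (s, ω))
    ((measurable_visit hξ hζ hB).comp measurable_swap).aemeasurable]
  exact lintegral_congr fun s => lintegral_visit hξ hζ hB s

lemma meanOccupation_ne_top [IsProbabilityMeasure P] (hξ : Measurable (Function.uncurry ξ))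
    {B : Set ℝ} (hB : MeasurableSet B) (T : ℝ) : meanOccupation P ξ ζ B T ≠ ⊤ := by
  refine ne_top_of_le_ne_top ?_ (lintegral_mono fun s => stateLaw_le_one hξ s hB)
  simp

lemma lintegral_visit_mul_le (hL : IsKilledLevy P ξ ζ) {B D : Set ℝ}
    (hB : MeasurableSet B) (hD : MeasurableSet D) (hBD : ∀ a ∈ B, ∀ b ∈ B, b - a ∈ D)
    {s t : ℝ} (hs : 0 ≤ s) (hst : s ≤ t) :
    ∫⁻ ω, (visitSet ξ ζ B).indicator 1 (s, ω) * (visitSet ξ ζ B).indicator 1 (t, ω) ∂P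
      ≤ stateLaw P ξ ζ s B * stateLaw P ξ ζ (t - s) D := by
  obtain ⟨hξ, hζ, -, hinc⟩ := hL
  have h := hinc s (t - s) hs (sub_nonneg.2 hst) (B.indicator 1) (D.indicator 1)
    (measurable_one.indicator hB) (measurable_one.indicator hD)
  rw [← lintegral_stateLaw hξ hζ s (measurable_one.indicator hB),
    ← lintegral_stateLaw hξ hζ _ (measurable_one.indicator hD),
    lintegral_indicator_one hB, lintegral_indicator_one hD] at h
  rw [← h]
  refine lintegral_mono fun ω => ?_
  simp only [add_sub_cancel]
  by_cases h1 : (s, ω) ∈ visitSet ξ ζ B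
  · by_cases h2 : (t, ω) ∈ visitSet ξ ζ B
    · have h3 : ω ∈ {ω | ENNReal.ofReal t < ζ ω} := h2.1
      have h4 : ξ s ω ∈ B := h1.2
      simp [indicator_of_mem h1, indicator_of_mem h2, indicator_of_mem h3,
        indicator_of_mem h4, indicator_of_mem (hBD _ h4 _ h2.2)]
    · simp [indicator_of_notMem h2]
  · simp [indicator_of_notMem h1]

lemma lintegral_occupation_sq_le [IsProbabilityMeasure P] (hL : IsKilledLevy P ξ ζ)
    {B D : Set ℝ} (hB : MeasurableSet B) (hD : MeasurableSet D)
    (hBD : ∀ a ∈ B, ∀ b ∈ B, b - a ∈ D) (T : ℝ) :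
    ∫⁻ ω, occupation ξ ζ B T ω ^ 2 ∂P
      ≤ 2 * (meanOccupation P ξ ζ B T * meanOccupation P ξ ζ D T) := by
  have hξ := hL.1
  have hζ := hL.2.1
  set v : ℝ → Ω → ℝ≥0∞ := fun s ω => (visitSet ξ ζ B).indicator 1 (s, ω) with hv
  have hvm : Measurable (Function.uncurry v) := measurable_visit hξ hζ hB
  set d : ℝ → ℝ≥0∞ := (Ico 0 T).indicator fun r => stateLaw P ξ ζ r D with hd
  have hdm : Measurable d := (measurable_stateLaw_apply hξ hζ hD).indicator measurableSet_Ico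
  have hqm : Measurable fun s => stateLaw P ξ ζ s B := measurable_stateLaw_apply hξ hζ hB
  have hdint : ∫⁻ r, d r = meanOccupation P ξ ζ D T := lintegral_indicator measurableSet_Ico _
  have hsq : ∀ ω, occupation ξ ζ B T ω ^ 2
      = ∫⁻ s in Ico 0 T, ∫⁻ t in Ico 0 T, v s ω * v t ω := by
    intro ω
    have hvω : Measurable fun s => v s ω := hvm.of_uncurry_right
    simp_rw [lintegral_const_mul _ hvω]
    rw [lintegral_mul_const _ hvω, sq]
    rfl
  have hJ : ∀ s ∈ Ico 0 T, ∀ t ∈ Ico 0 T, ∫⁻ ω, v s ω * v t ω ∂P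
      ≤ stateLaw P ξ ζ s B * d (t - s) + stateLaw P ξ ζ t B * d (s - t) := by
    intro s hs t ht
    rcases le_total s t with hst | hst
    · refine le_add_right ?_
      rw [hd, indicator_of_mem
        (show t - s ∈ Ico 0 T from ⟨sub_nonneg.2 hst, by linarith [hs.1, ht.2]⟩)]
      exact lintegral_visit_mul_le hL hB hD hBD hs.1 hst
    · refine le_add_left ?_
      rw [hd, indicator_of_mem
        (show s - t ∈ Ico 0 T from ⟨sub_nonneg.2 hst, by linarith [hs.2, ht.1]⟩)]
      simp_rw [mul_comm (v s _)]
      exact lintegral_visit_mul_le hL hB hD hBD ht.1 hst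
  have hm1 : Measurable fun p : ℝ × ℝ => stateLaw P ξ ζ p.1 B * d (p.2 - p.1) :=
    (hqm.comp measurable_fst).mul (hdm.comp (measurable_snd.sub measurable_fst))
  have hbound : ∀ s, ∫⁻ t in Ico 0 T, stateLaw P ξ ζ s B * d (t - s)
      ≤ stateLaw P ξ ζ s B * meanOccupation P ξ ζ D T := by
    intro s
    refine (setLIntegral_le_lintegral _ _).trans ?_
    rw [lintegral_const_mul _ (by fun_prop),
      lintegral_sub_right_eq_self d s, hdint]
  have hfirst : ∫⁻ s in Ico 0 T, ∫⁻ t in Ico 0 T, stateLaw P ξ ζ s B * d (t - s)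
      ≤ meanOccupation P ξ ζ B T * meanOccupation P ξ ζ D T := by
    refine (lintegral_mono hbound).trans ?_
    rw [lintegral_mul_const _ hqm]
    rfl
  calc ∫⁻ ω, occupation ξ ζ B T ω ^ 2 ∂P
      = ∫⁻ s in Ico 0 T, ∫⁻ t in Ico 0 T, ∫⁻ ω, v s ω * v t ω ∂P := by
        simp_rw [hsq]
        rw [lintegral_lintegral_swap]
        · refine lintegral_congr fun s => ?_
          rw [lintegral_lintegral_swap]
          exact ((hvm.comp (measurable_const.prodMk measurable_fst)).mul
            (hvm.comp measurable_swap)).aemeasurable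
        · refine Measurable.aemeasurable ?_
          refine Measurable.lintegral_prod_right'
            (f := fun p : (Ω × ℝ) × ℝ => v p.1.2 p.1.1 * v p.2 p.1.1) ?_
          exact (hvm.comp (measurable_fst.snd.prodMk measurable_fst.fst)).mul
            (hvm.comp (measurable_snd.prodMk measurable_fst.fst))
    _ ≤ ∫⁻ s in Ico 0 T, ∫⁻ t in Ico 0 T,
          (stateLaw P ξ ζ s B * d (t - s) + stateLaw P ξ ζ t B * d (s - t)) :=
        setLIntegral_mono' measurableSet_Ico fun s hs =>
          setLIntegral_mono' measurableSet_Ico fun t ht => hJ s hs t ht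
    _ = (∫⁻ s in Ico 0 T, ∫⁻ t in Ico 0 T, stateLaw P ξ ζ s B * d (t - s))
          + ∫⁻ s in Ico 0 T, ∫⁻ t in Ico 0 T, stateLaw P ξ ζ t B * d (s - t) := by
        rw [← lintegral_add_left hm1.lintegral_prod_right']
        refine lintegral_congr fun s => ?_
        rw [lintegral_add_left (hm1.of_uncurry_left (f := fun s t => stateLaw P ξ ζ s B * d (t - s)))]
    _ = (∫⁻ s in Ico 0 T, ∫⁻ t in Ico 0 T, stateLaw P ξ ζ s B * d (t - s))
          + ∫⁻ s in Ico 0 T, ∫⁻ t in Ico 0 T, stateLaw P ξ ζ s B * d (t - s) := by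
        congr 1
        exact lintegral_lintegral_swap (hm1.comp measurable_swap).aemeasurable
    _ ≤ _ := by rw [two_mul]; exact add_le_add hfirst hfirst

lemma meanOccupation_le_two_mul [IsProbabilityMeasure P] (hL : IsKilledLevy P ξ ζ)
    {B D : Set ℝ} (hB : MeasurableSet B) (hD : MeasurableSet D)
    (hBD : ∀ a ∈ B, ∀ b ∈ B, b - a ∈ D) (T : ℝ) :
    meanOccupation P ξ ζ B T ≤ 2 * meanOccupation P ξ ζ D T := by
  have h := sq_setLIntegral_le P (measurable_occupation hL.1 hL.2.1 hB T) univ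
  rw [Measure.restrict_univ, measure_univ, one_mul,
    lintegral_occupation hL.1 hL.2.1 hB] at h
  have h2 := h.trans (lintegral_occupation_sq_le hL hB hD hBD T)
  rcases eq_or_ne (meanOccupation P ξ ζ B T) 0 with h0 | h0
  · simp [h0]
  · rw [sq, mul_left_comm] at h2
    exact (ENNReal.mul_le_mul_iff_right h0 (meanOccupation_ne_top hL.1 hB T)).1 h2

lemma meanOccupation_Ico_le [IsProbabilityMeasure P] (hL : IsKilledLevy P ξ ζ) (z T : ℝ) :
    meanOccupation P ξ ζ (Ico z (z + 1)) T ≤ 2 * meanOccupation P ξ ζ (Ioo (-1) 1) T :=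
  meanOccupation_le_two_mul hL measurableSet_Ico measurableSet_Ioo
    (fun a ha b hb => ⟨by linarith [ha.2, hb.1], by linarith [ha.1, hb.2]⟩) T

lemma meanOccupation_Ioo_two_le [IsProbabilityMeasure P] (hL : IsKilledLevy P ξ ζ) (T : ℝ) :
    meanOccupation P ξ ζ (Ioo (-2) 2) T ≤ 8 * meanOccupation P ξ ζ (Ioo (-1) 1) T := by
  have hq : ∀ z : ℝ, Measurable fun s => stateLaw P ξ ζ s (Ico z (z + 1)) := fun z =>
    measurable_stateLaw_apply hL.1 hL.2.1 measurableSet_Ico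
  have hcov : Ioo (-2 : ℝ) 2 ⊆ ((Ico (-2) (-2 + 1) ∪ Ico (-1) (-1 + 1)) ∪ Ico 0 (0 + 1))
      ∪ Ico 1 (1 + 1) := by
    intro x hx
    simp only [mem_union, mem_Ico]
    obtain ⟨h1, h2⟩ := hx
    rcases lt_or_ge x (-1) with h | h
    · exact Or.inl (Or.inl (Or.inl ⟨h1.le, by linarith⟩))
    rcases lt_or_ge x 0 with h' | h'
    · exact Or.inl (Or.inl (Or.inr ⟨h, by linarith⟩))
    rcases lt_or_ge x 1 with h'' | h''
    · exact Or.inl (Or.inr ⟨h', by linarith⟩)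
    · exact Or.inr ⟨h'', by linarith⟩
  calc meanOccupation P ξ ζ (Ioo (-2) 2) T
      ≤ ∫⁻ s in Ico 0 T, (((stateLaw P ξ ζ s (Ico (-2) (-2 + 1))
          + stateLaw P ξ ζ s (Ico (-1) (-1 + 1))) + stateLaw P ξ ζ s (Ico 0 (0 + 1)))
          + stateLaw P ξ ζ s (Ico 1 (1 + 1))) := by
        refine lintegral_mono fun s => (measure_mono hcov).trans ?_
        refine (measure_union_le _ _).trans (add_le_add_left ?_ _)
        refine (measure_union_le _ _).trans (add_le_add_left ?_ _)
        exact measure_union_le _ _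
    _ = ((meanOccupation P ξ ζ (Ico (-2) (-2 + 1)) T
          + meanOccupation P ξ ζ (Ico (-1) (-1 + 1)) T)
          + meanOccupation P ξ ζ (Ico 0 (0 + 1)) T)
          + meanOccupation P ξ ζ (Ico 1 (1 + 1)) T := by
        rw [lintegral_add_right _ (hq 1), lintegral_add_right _ (hq 0),
          lintegral_add_right _ (hq (-1))]
        rfl
    _ ≤ ((2 * meanOccupation P ξ ζ (Ioo (-1) 1) T + 2 * meanOccupation P ξ ζ (Ioo (-1) 1) T)
          + 2 * meanOccupation P ξ ζ (Ioo (-1) 1) T)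
          + 2 * meanOccupation P ξ ζ (Ioo (-1) 1) T := by
        gcongr <;> exact meanOccupation_Ico_le hL _ T
    _ = 8 * meanOccupation P ξ ζ (Ioo (-1) 1) T := by ring

lemma measurable_expFunctional (hξ : Measurable (Function.uncurry ξ)) (hζ : Measurable ζ)
    (α : ℝ) : Measurable (expFunctional α ξ ζ) := by
  refine Measurable.lintegral_prod_left' (f := fun p : ℝ × Ω =>
    {p : ℝ × Ω | ENNReal.ofReal p.1 < ζ p.2}.indicator
      (fun p => ENNReal.ofReal (Real.exp (α * ξ p.1 p.2))) p) ?_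
  exact (ENNReal.measurable_ofReal.comp (Real.measurable_exp.comp
    (measurable_const.mul hξ))).indicator (measurableSet_alive_prod hζ)

lemma occupation_le_expFunctional {α : ℝ} (hα : 0 < α) (T : ℝ) (ω : Ω)
    (hξ : Measurable (Function.uncurry ξ)) :
    occupation ξ ζ (Ioo (-1) 1) T ω
      ≤ ENNReal.ofReal (Real.exp α) * expFunctional α ξ ζ ω := by
  have hm : Measurable fun u => {u : ℝ | ENNReal.ofReal u < ζ ω}.indicator
      (fun u => ENNReal.ofReal (Real.exp (α * ξ u ω))) u :=
    (ENNReal.measurable_ofReal.comp (Real.measurable_exp.comp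
      (measurable_const.mul hξ.of_uncurry_right))).indicator
      (measurableSet_lt ENNReal.measurable_ofReal measurable_const)
  rw [occupation, expFunctional, ← lintegral_const_mul _ hm,
    setLIntegral_congr Ioi_ae_eq_Ici]
  refine (lintegral_mono_set Ico_subset_Ici_self).trans (lintegral_mono fun s => ?_)
  by_cases h : (s, ω) ∈ visitSet ξ ζ (Ioo (-1) 1)
  · have h1 : s ∈ {u : ℝ | ENNReal.ofReal u < ζ ω} := h.1
    simp only [indicator_of_mem h, indicator_of_mem h1, Pi.one_apply]
    rw [← ENNReal.ofReal_mul (Real.exp_pos _).le, ← Real.exp_add, ENNReal.one_le_ofReal]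
    have h2 : -1 < ξ s ω := h.2.1
    exact Real.one_le_exp (by nlinarith)
  · simp [indicator_of_notMem h]

/-- If the exponential functional is a.s. finite, the potential measure of unit intervals is
uniformly bounded. -/
lemma exists_potential_Ico_le [IsProbabilityMeasure P] {α : ℝ} (hα : 0 < α)
    (hL : IsKilledLevy P ξ ζ) (hHit : ∀ᵐ ω ∂P, expFunctional α ξ ζ ω < ⊤) :
    ∃ C : ℝ≥0∞, C ≠ ⊤ ∧ ∀ z : ℝ, ∫⁻ s in Ioi 0, stateLaw P ξ ζ s (Ico z (z + 1)) ≤ C := by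
  have hξ := hL.1
  have hζ := hL.2.1
  set J : Ω → ℝ≥0∞ := fun ω => ENNReal.ofReal (Real.exp α) * expFunctional α ξ ζ ω with hJ
  have hJm : Measurable J := (measurable_expFunctional hξ hζ α).const_mul _
  obtain ⟨M, hM⟩ : ∃ M : ℕ, P {ω | (M : ℝ≥0∞) < J ω} < 1 / 64 := by
    have hlim : Tendsto (fun n : ℕ => P {ω | (n : ℝ≥0∞) < J ω}) atTop
        (nhds (P (⋂ n : ℕ, {ω | (n : ℝ≥0∞) < J ω}))) := by
      refine tendsto_measure_iInter_atTop
        (fun n => (measurableSet_lt measurable_const hJm).nullMeasurableSet) ?_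
        ⟨0, measure_ne_top _ _⟩
      exact fun m n hmn ω (hω : (n : ℝ≥0∞) < J ω) => (Nat.cast_le.2 hmn).trans_lt hω
    have hzero : P (⋂ n : ℕ, {ω | (n : ℝ≥0∞) < J ω}) = 0 := by
      refine measure_mono_null (t := {ω | ¬ expFunctional α ξ ζ ω < ⊤}) ?_ hHit
      intro ω hω hfin
      obtain ⟨n, hn⟩ := ENNReal.exists_nat_gt (ENNReal.mul_lt_top ENNReal.ofReal_lt_top hfin).ne
      exact lt_asymm hn (mem_iInter.1 hω n)
    rw [hzero] at hlim
    exact (hlim.eventually (gt_mem_nhds (by norm_num))).exists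
  have hU : ∀ T, meanOccupation P ξ ζ (Ioo (-1) 1) T ≤ 2 * M := by
    intro T
    set U := meanOccupation P ξ ζ (Ioo (-1) 1) T with hUdef
    have hUtop : U ≠ ⊤ := meanOccupation_ne_top hξ measurableSet_Ioo T
    have hAm := measurable_occupation hξ hζ (measurableSet_Ioo (a := (-1 : ℝ)) (b := 1)) T
    have hsq : ∫⁻ ω, occupation ξ ζ (Ioo (-1) 1) T ω ^ 2 ∂P ≤ 16 * U ^ 2 := by
      refine (lintegral_occupation_sq_le hL measurableSet_Ioo
        (measurableSet_Ioo (a := (-2 : ℝ)) (b := 2)) (fun a ha b hb =>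
          ⟨by linarith [ha.2, hb.1], by linarith [ha.1, hb.2]⟩) T).trans ?_
      calc 2 * (U * meanOccupation P ξ ζ (Ioo (-2) 2) T) ≤ 2 * (U * (8 * U)) := by
            gcongr; exact meanOccupation_Ioo_two_le hL T
        _ = 16 * U ^ 2 := by ring
    set E := {ω | (M : ℝ≥0∞) < J ω} with hE
    have hEm : MeasurableSet E := measurableSet_lt measurable_const hJm
    have hbig : ∫⁻ ω in E, occupation ξ ζ (Ioo (-1) 1) T ω ∂P ≤ U / 2 := by
      have h := (sq_setLIntegral_le P hAm E).trans (mul_le_mul' hM.le hsq)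
      have h' : (1 / 64 : ℝ≥0∞) * (16 * U ^ 2) = (U / 2) ^ 2 := by
        rw [← ENNReal.toReal_eq_toReal_iff' (by finiteness) (by finiteness)]
        simp only [ENNReal.toReal_mul, ENNReal.toReal_div, ENNReal.toReal_pow,
          ENNReal.toReal_one, ENNReal.toReal_ofNat]
        ring
      rw [h'] at h
      exact (ENNReal.pow_le_pow_left_iff two_ne_zero).1 h
    have hsmall : ∫⁻ ω in Eᶜ, occupation ξ ζ (Ioo (-1) 1) T ω ∂P ≤ M := by
      calc ∫⁻ ω in Eᶜ, occupation ξ ζ (Ioo (-1) 1) T ω ∂P ≤ ∫⁻ _ in Eᶜ, (M : ℝ≥0∞) ∂P :=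
            setLIntegral_mono' hEm.compl fun ω hω =>
              (occupation_le_expFunctional hα T ω hξ).trans (not_lt.1 hω)
        _ = M * P Eᶜ := by simp
        _ ≤ M * 1 := by gcongr; exact prob_le_one
        _ = M := mul_one _
    have htot : U ≤ U / 2 + M := by
      calc U = (∫⁻ ω in E, occupation ξ ζ (Ioo (-1) 1) T ω ∂P)
            + ∫⁻ ω in Eᶜ, occupation ξ ζ (Ioo (-1) 1) T ω ∂P := by
            rw [lintegral_add_compl _ hEm, lintegral_occupation hξ hζ measurableSet_Ioo]
        _ ≤ U / 2 + M := add_le_add hbig hsmall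
    have hr := ENNReal.toReal_mono (by finiteness) htot
    rw [ENNReal.toReal_add (by finiteness) (by finiteness), ENNReal.toReal_div] at hr
    rw [← ENNReal.toReal_le_toReal hUtop (by finiteness), ENNReal.toReal_mul]
    simp only [ENNReal.toReal_ofNat] at hr ⊢
    linarith
  refine ⟨2 * (2 * M), by finiteness, fun z => ?_⟩
  have hsub : Ioi (0 : ℝ) ⊆ ⋃ n : ℕ, Ico (0 : ℝ) n := fun s hs => by
    obtain ⟨n, hn⟩ := exists_nat_gt s
    exact mem_iUnion.2 ⟨n, le_of_lt hs, hn⟩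
  refine (lintegral_mono_set hsub).trans ?_
  rw [setLIntegral_iUnion_of_directed]
  · exact iSup_le fun n => (meanOccupation_Ico_le hL z n).trans (by gcongr; exact hU n)
  · exact directed_of_isDirected_le fun m n hmn => Ico_subset_Ico_right (Nat.cast_le.2 hmn)

end Transience

lemma measurable_sInf_lt {β : Type*} [MeasurableSpace β] {c : ℝ → β → ℝ≥0∞}
    (hc : ∀ s, Measurable (c s)) (hmono : ∀ b, Monotone fun s => c s b) {ρ : β → ℝ≥0∞}
    (hρ : Measurable ρ) : Measurable fun b => sInf {s : ℝ | 0 < s ∧ ρ b < c s b} := by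
  refine measurable_of_Iio fun a => ?_
  have hnonneg : ∀ b, 0 ≤ sInf {s : ℝ | 0 < s ∧ ρ b < c s b} := fun b =>
    Real.sInf_nonneg fun s hs => hs.1.le
  rcases le_or_gt a 0 with ha | ha
  · convert MeasurableSet.empty
    ext b
    simpa using ha.trans (hnonneg b)
  have hset : (fun b => sInf {s : ℝ | 0 < s ∧ ρ b < c s b}) ⁻¹' Iio a
      = {b | ∃ q : ℚ, (0 < (q : ℝ) ∧ (q : ℝ) < a) ∧ ρ b < c q b}
        ∪ {b | ∀ q : ℚ, 0 < (q : ℝ) → ¬ ρ b < c q b} := by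
    ext b
    have hbdd : BddBelow {s : ℝ | 0 < s ∧ ρ b < c s b} := ⟨0, fun s hs => hs.1.le⟩
    simp only [mem_preimage, mem_Iio, mem_union, mem_ofPred_eq]
    constructor
    · intro h
      rcases eq_empty_or_nonempty {s : ℝ | 0 < s ∧ ρ b < c s b} with he | hne
      · refine Or.inr fun q hq hlt => ?_
        have : (q : ℝ) ∈ {s : ℝ | 0 < s ∧ ρ b < c s b} := ⟨hq, hlt⟩
        simp [he] at this
      · obtain ⟨s, hs, hsa⟩ := (csInf_lt_iff hbdd hne).1 h
        obtain ⟨q, hq1, hq2⟩ := exists_rat_btwn hsa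
        exact Or.inl ⟨q, ⟨hs.1.trans hq1, hq2⟩, hs.2.trans_le (hmono b hq1.le)⟩
    · rintro (⟨q, ⟨hq0, hqa⟩, hlt⟩ | h)
      · exact (csInf_le hbdd ⟨hq0, hlt⟩).trans_lt hqa
      · have he : {s : ℝ | 0 < s ∧ ρ b < c s b} = ∅ := by
          refine eq_empty_of_forall_notMem fun s hs => ?_
          obtain ⟨q, hq1, -⟩ := exists_rat_btwn (lt_add_one s)
          exact h q (hs.1.trans hq1) (hs.2.trans_le (hmono b hq1.le))
        rw [he, Real.sInf_empty]
        exact ha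
  rw [hset]
  refine MeasurableSet.union ?_ ?_
  · simp only [ofPred_exists]
    refine MeasurableSet.iUnion fun q => ?_
    exact (MeasurableSet.const _).inter (measurableSet_lt hρ (hc q))
  · simp only [ofPred_forall]
    refine MeasurableSet.iInter fun q => MeasurableSet.iInter fun _ => ?_
    exact (measurableSet_lt hρ (hc q)).compl

lemma exists_lt_setLIntegral_Ioo {w : ℝ → ℝ≥0∞} {A : Set ℝ} {u : ℕ → ℝ} (hu : Monotone u)
    (hA : A = ⋃ n, Ioo 0 (u n)) {ρ : ℝ≥0∞} (h : ρ < ∫⁻ s in A, w s) :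
    ∃ n, ρ < ∫⁻ s in Ioo 0 (u n), w s := by
  rw [hA, setLIntegral_iUnion_of_directed _
    (directed_of_isDirected_le fun m n hmn => Ioo_subset_Ioo_right (hu hmn))] at h
  exact lt_iSup_iff.1 h

/-- Change of variables along the right-continuous inverse of `s ↦ ∫_0^s w`. -/
lemma lintegral_comp_inverse_clock {w : ℝ → ℝ≥0∞} (hw : Measurable w)
    (hfin : ∫⁻ s in Ioi 0, w s ≠ ⊤) {G : ℝ → ℝ≥0∞} (hG : Measurable G) :
    ∫⁻ r in Ioi 0, {r : ℝ | ENNReal.ofReal r < ∫⁻ s in Ioi 0, w s}.indicator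
        (fun r => G (sInf {s : ℝ | 0 < s ∧ ENNReal.ofReal r < ∫⁻ u in Ioo 0 s, w u})) r
      = ∫⁻ s in Ioi 0, w s * G s := by
  set W := ∫⁻ s in Ioi 0, w s with hW
  set C : ℝ → ℝ≥0∞ := fun s => ∫⁻ u in Ioo 0 s, w u with hC
  set τ : ℝ → ℝ := fun r => sInf {s : ℝ | 0 < s ∧ ENNReal.ofReal r < C s} with hτ
  have hCW : ∀ s, C s ≤ W := fun s => lintegral_mono_set Ioo_subset_Ioi_self
  have hCmono : Monotone C := fun s t hst => lintegral_mono_set (Ioo_subset_Ioo_right hst)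
  have hτm : Measurable τ := measurable_sInf_lt (c := fun s _ => C s)
    (fun _ => measurable_const) (fun _ => hCmono) ENNReal.measurable_ofReal
  have hIoo : ∀ v : ℝ≥0∞, v ≠ ⊤ → Ioi 0 ∩ {r : ℝ | ENNReal.ofReal r < v} = Ioo 0 v.toReal := by
    intro v hv
    ext r
    simp only [mem_inter_iff, mem_Ioi, mem_ofPred_eq, mem_Ioo]
    exact and_congr_right fun hr => ENNReal.ofReal_lt_iff_lt_toReal hr.le hv
  have hmeas : MeasurableSet {r : ℝ | ENNReal.ofReal r < W} :=
    measurableSet_lt ENNReal.measurable_ofReal measurable_const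
  have hpre : ∀ a, 0 < a → τ ⁻¹' Iio a ∩ Ioo 0 W.toReal = Ioo 0 (C a).toReal := by
    intro a ha
    rw [← hIoo W hfin, ← hIoo (C a) (ne_top_of_le_ne_top hfin (hCW a))]
    ext r
    have hbdd : BddBelow {s : ℝ | 0 < s ∧ ENNReal.ofReal r < C s} := ⟨0, fun s hs => hs.1.le⟩
    simp only [mem_inter_iff, mem_preimage, mem_Iio, mem_Ioi, mem_ofPred_eq]
    constructor
    · rintro ⟨hra, hr0, hrW⟩
      have hne : {s : ℝ | 0 < s ∧ ENNReal.ofReal r < C s}.Nonempty := by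
        obtain ⟨n, hn⟩ := exists_lt_setLIntegral_Ioo (u := fun n : ℕ => (n : ℝ))
          Nat.mono_cast (by
            ext s
            simp only [mem_Ioi, mem_iUnion, mem_Ioo]
            exact ⟨fun hs => (exists_nat_gt s).imp fun n hn => ⟨hs, hn⟩,
              fun ⟨_, hs, _⟩ => hs⟩) hrW
        refine ⟨n, ?_, hn⟩
        by_contra hn0
        rw [Ioo_eq_empty hn0] at hn
        simp at hn
      obtain ⟨s, hs, hsa⟩ := (csInf_lt_iff hbdd hne).1 hra
      exact ⟨hr0, hs.2.trans_le (hCmono hsa.le)⟩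
    · rintro ⟨hr0, hra⟩
      refine ⟨?_, hr0, hra.trans_le (hCW a)⟩
      obtain ⟨n, hn⟩ := exists_lt_setLIntegral_Ioo (u := fun n : ℕ => a - 1 / ((n : ℝ) + 1))
        (fun m n hmn => sub_le_sub_left (Nat.one_div_le_one_div hmn) a) (by
          ext s
          simp only [mem_iUnion, mem_Ioo]
          constructor
          · rintro ⟨hs0, hsa⟩
            obtain ⟨n, hn⟩ := exists_nat_one_div_lt (sub_pos.2 hsa)
            exact ⟨n, hs0, by linarith⟩
          · rintro ⟨n, hs0, hsn⟩
            exact ⟨hs0, hsn.trans (sub_lt_self _ Nat.one_div_pos_of_nat)⟩) hra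
      have hpos : 0 < a - 1 / ((n : ℝ) + 1) := by
        by_contra hn0
        rw [Ioo_eq_empty hn0] at hn
        simp at hn
      exact (csInf_le hbdd ⟨hpos, hn⟩).trans_lt (sub_lt_self _ Nat.one_div_pos_of_nat)
  have hlaw : (volume.restrict (Ioo 0 W.toReal)).map τ
      = (volume.restrict (Ioi (0 : ℝ))).withDensity w := by
    refine ext_of_generate_finite (range Iio)
      ((BorelSpace.measurable_eq (α := ℝ)).trans (borel_eq_generateFrom_Iio ℝ))
      isPiSystem_Iio ?_ ?_
    · rintro _ ⟨a, rfl⟩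
      rw [Measure.map_apply hτm measurableSet_Iio,
        Measure.restrict_apply (hτm measurableSet_Iio), withDensity_apply _ measurableSet_Iio,
        Measure.restrict_restrict measurableSet_Iio]
      rcases le_or_gt a 0 with ha | ha
      · have h1 : τ ⁻¹' Iio a = ∅ := by
          refine eq_empty_of_forall_notMem fun r hr => ?_
          exact (ha.trans (Real.sInf_nonneg fun s hs => hs.1.le)).not_gt hr
        have h2 : Iio a ∩ Ioi 0 = (∅ : Set ℝ) := by
          rw [inter_comm, Ioi_inter_Iio, Ioo_eq_empty ha.not_gt]
        simp [h1, h2]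
      · rw [hpre a ha, inter_comm, Ioi_inter_Iio, Real.volume_Ioo, sub_zero,
          ENNReal.ofReal_toReal (ne_top_of_le_ne_top hfin (hCW a))]
    · rw [Measure.map_apply hτm MeasurableSet.univ, preimage_univ,
        Measure.restrict_apply_univ, Real.volume_Ioo, sub_zero, ENNReal.ofReal_toReal hfin,
        withDensity_apply _ MeasurableSet.univ, Measure.restrict_univ]
  calc _ = ∫⁻ r in Ioo 0 W.toReal, G (τ r) := by
        rw [lintegral_indicator hmeas, Measure.restrict_restrict hmeas, inter_comm, hIoo W hfin]
    _ = ∫⁻ s, G s ∂((volume.restrict (Ioo 0 W.toReal)).map τ) := (lintegral_map hG hτm).symm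
    _ = ∫⁻ s in Ioi 0, w s * G s := by
        rw [hlaw, lintegral_withDensity_eq_lintegral_mul _ hw hG]
        rfl

/-- The test function `u ↦ u^{-α} k(log u)`. -/
def logTest (α : ℝ) (k : ℝ → ℝ≥0∞) (u : ℝ) : ℝ≥0∞ :=
  ENNReal.ofReal (Real.exp (-α * Real.log u)) * k (Real.log u)

lemma measurable_logTest (α : ℝ) {k : ℝ → ℝ≥0∞} (hk : Measurable k) :
    Measurable (logTest α k) :=
  (ENNReal.measurable_ofReal.comp (Real.measurable_exp.comp
    (Real.measurable_log.const_mul _))).mul (hk.comp Real.measurable_log)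

section Lamperti

variable [MeasurableSpace Ω] {P : Measure Ω} {ξ : ℝ → Ω → ℝ} {ζ : Ω → ℝ≥0∞}

lemma measurable_speed (hξ : Measurable (Function.uncurry ξ)) (hζ : Measurable ζ) (α : ℝ) :
    Measurable fun p : ℝ × Ω => {u : ℝ | ENNReal.ofReal u < ζ p.2}.indicator
      (fun u => ENNReal.ofReal (Real.exp (α * ξ u p.2))) p.1 :=
  (ENNReal.measurable_ofReal.comp (Real.measurable_exp.comp
    (measurable_const.mul hξ))).indicator (measurableSet_alive_prod hζ)

lemma measurable_lampertiTimeChange (hξ : Measurable (Function.uncurry ξ)) (hζ : Measurable ζ)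
    (α : ℝ) : Measurable fun p : ℝ × Ω => lampertiTimeChange α ξ ζ p.2 p.1 := by
  refine measurable_sInf_lt (c := fun s (p : ℝ × Ω) => lampertiClock α ξ ζ p.2 s) (fun s => ?_)
    (fun p s t hst => lintegral_mono_set (Ioo_subset_Ioo_right hst))
    (ENNReal.measurable_ofReal.comp measurable_fst)
  exact (measurable_speed hξ hζ α).lintegral_prod_left'.comp measurable_snd

/-- The integrand `f(X_r) 1_{r < T_0}` for the pssMp started from `x`, in the time scale of the
unit starting point. -/
def lampertiValue (α : ℝ) (ξ : ℝ → Ω → ℝ) (ζ : Ω → ℝ≥0∞) (f : ℝ → ℝ≥0∞) (x r : ℝ) (ω : Ω) :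
    ℝ≥0∞ :=
  {r : ℝ | ENNReal.ofReal r < expFunctional α ξ ζ ω}.indicator
    (fun r => f (x * Real.exp (ξ (lampertiTimeChange α ξ ζ ω r) ω))) r

lemma measurable_lampertiValue (hξ : Measurable (Function.uncurry ξ)) (hζ : Measurable ζ)
    (α : ℝ) {f : ℝ → ℝ≥0∞} (hf : Measurable f) :
    Measurable fun p : (ℝ × ℝ) × Ω => lampertiValue α ξ ζ f p.1.1 p.1.2 p.2 := by
  have hset : MeasurableSet {p : (ℝ × ℝ) × Ω |
      ENNReal.ofReal p.1.2 < expFunctional α ξ ζ p.2} :=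
    measurableSet_lt (ENNReal.measurable_ofReal.comp measurable_fst.snd)
      ((measurable_expFunctional hξ hζ α).comp measurable_snd)
  refine Measurable.indicator (f := fun p : (ℝ × ℝ) × Ω =>
    f (p.1.1 * Real.exp (ξ (lampertiTimeChange α ξ ζ p.2 p.1.2) p.2))) ?_ hset
  refine hf.comp (measurable_fst.fst.mul (Real.measurable_exp.comp ?_))
  exact hξ.comp (((measurable_lampertiTimeChange hξ hζ α).comp
    (measurable_fst.snd.prodMk measurable_snd)).prodMk measurable_snd)

lemma lintegral_lampertiSemigroup (hξ : Measurable (Function.uncurry ξ)) (hζ : Measurable ζ)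
    (α t x : ℝ) {f : ℝ → ℝ≥0∞} (hf : Measurable f) :
    ∫⁻ y, f y ∂(lampertiSemigroup α ξ ζ P t x)
      = ∫⁻ ω, lampertiValue α ξ ζ f x (t / x ^ α) ω ∂P := by
  have hm : Measurable fun ω =>
      x * Real.exp (ξ (lampertiTimeChange α ξ ζ ω (t / x ^ α)) ω) :=
    (Real.measurable_exp.comp (hξ.comp (((measurable_lampertiTimeChange hξ hζ α).comp
      (measurable_const.prodMk measurable_id)).prodMk measurable_id))).const_mul x
  rw [lampertiSemigroup, lintegral_map hf hm, ← lintegral_indicator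
    (measurableSet_lt measurable_const (measurable_expFunctional hξ hζ α))]
  rfl

/-- Potential of the pssMp in terms of the potential of the underlying Lévy process. -/
lemma lintegral_lampertiSemigroup_logTest [IsProbabilityMeasure P]
    (hξ : Measurable (Function.uncurry ξ)) (hζ : Measurable ζ) {α : ℝ}
    (hHit : ∀ᵐ ω ∂P, expFunctional α ξ ζ ω < ⊤) {x : ℝ} (hx : 0 < x) {k : ℝ → ℝ≥0∞}
    (hk : Measurable k) :
    ∫⁻ t in Ioi 0, ∫⁻ y, logTest α k y ∂(lampertiSemigroup α ξ ζ P t x)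
      = ∫⁻ s in Ioi 0, ∫⁻ y, k (Real.log x + y) ∂(stateLaw P ξ ζ s) := by
  have hf := measurable_logTest α hk
  have hxα : 0 < x ^ α := Real.rpow_pos_of_pos hx α
  have hkx : Measurable fun y => k (Real.log x + y) := hk.comp (measurable_const_add _)
  have hpath : ∀ ω, expFunctional α ξ ζ ω < ⊤ →
      ∫⁻ t in Ioi 0, lampertiValue α ξ ζ (logTest α k) x (t / x ^ α) ω
        = ∫⁻ s in Ioi 0, {p : ℝ × Ω | ENNReal.ofReal p.1 < ζ p.2}.indicator
            (fun p => k (Real.log x + ξ p.1 p.2)) (s, ω) := by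
    intro ω hω
    have himg : (fun r => x ^ α * r) '' Ioi 0 = Ioi 0 := by
      rw [image_mul_left_Ioi hxα, mul_zero]
    have hw : Measurable fun u => {u : ℝ | ENNReal.ofReal u < ζ ω}.indicator
        (fun u => ENNReal.ofReal (Real.exp (α * ξ u ω))) u :=
      (measurable_speed hξ hζ α).comp (measurable_id.prodMk measurable_const)
    have hG : Measurable fun s => logTest α k (x * Real.exp (ξ s ω)) :=
      hf.comp ((Real.measurable_exp.comp hξ.of_uncurry_right).const_mul x)
    calc ∫⁻ t in Ioi 0, lampertiValue α ξ ζ (logTest α k) x (t / x ^ α) ω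
        = ∫⁻ r in Ioi 0, ENNReal.ofReal (x ^ α) * lampertiValue α ξ ζ (logTest α k) x r ω := by
          conv_lhs => rw [← himg]
          rw [lintegral_image_eq_lintegral_abs_deriv_mul measurableSet_Ioi
            (f' := fun _ => x ^ α)
            (fun r _ => by simpa using ((hasDerivAt_id r).const_mul (x ^ α)).hasDerivWithinAt)
            (mul_right_injective₀ hxα.ne').injOn]
          refine lintegral_congr fun r => ?_
          rw [abs_of_pos hxα, mul_div_cancel_left₀ _ hxα.ne']
      _ = ENNReal.ofReal (x ^ α) * ∫⁻ r in Ioi 0, lampertiValue α ξ ζ (logTest α k) x r ω :=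
          lintegral_const_mul' _ _ ENNReal.ofReal_ne_top
      _ = ENNReal.ofReal (x ^ α) * ∫⁻ s in Ioi 0, {u : ℝ | ENNReal.ofReal u < ζ ω}.indicator
            (fun u => ENNReal.ofReal (Real.exp (α * ξ u ω))) s
              * logTest α k (x * Real.exp (ξ s ω)) := by
          congr 1
          exact lintegral_comp_inverse_clock hw hω.ne hG
      _ = _ := by
          rw [← lintegral_const_mul' _ _ ENNReal.ofReal_ne_top]
          refine lintegral_congr fun s => ?_
          by_cases h : ENNReal.ofReal s < ζ ω
          · simp only [indicator_of_mem (show s ∈ {u : ℝ | ENNReal.ofReal u < ζ ω} from h),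
              indicator_of_mem (show (s, ω) ∈ {p : ℝ × Ω | ENNReal.ofReal p.1 < ζ p.2} from h),
              logTest, Real.log_mul hx.ne' (Real.exp_pos _).ne', Real.log_exp]
            rw [← mul_assoc, ← mul_assoc, ← ENNReal.ofReal_mul hxα.le,
              ← ENNReal.ofReal_mul (by positivity), Real.rpow_def_of_pos hx, ← Real.exp_add,
              ← Real.exp_add]
            ring_nf
            simp
          · simp [h]
  have hm : Measurable fun p : ℝ × Ω =>
      lampertiValue α ξ ζ (logTest α k) x (p.1 / x ^ α) p.2 :=
    (measurable_lampertiValue hξ hζ α hf).comp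
      ((measurable_const.prodMk (measurable_fst.div_const _)).prodMk measurable_snd)
  have hm' : Measurable ({p : ℝ × Ω | ENNReal.ofReal p.1 < ζ p.2}.indicator
      (fun p => k (Real.log x + ξ p.1 p.2))) :=
    (hkx.comp hξ).indicator (measurableSet_alive_prod hζ)
  simp_rw [lintegral_lampertiSemigroup hξ hζ α _ x hf, lintegral_stateLaw hξ hζ _ hkx]
  rw [lintegral_lintegral_swap (f := fun t ω =>
    lampertiValue α ξ ζ (logTest α k) x (t / x ^ α) ω) hm.aemeasurable]
  rw [lintegral_congr_ae (hHit.mono hpath), lintegral_lintegral_swap (f := fun ω s =>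
    {p : ℝ × Ω | ENNReal.ofReal p.1 < ζ p.2}.indicator
      (fun p => k (Real.log x + ξ p.1 p.2)) (s, ω)) (hm'.comp measurable_swap).aemeasurable]
  rfl

lemma lintegral_scaling_logTest {α : ℝ} (hα : 0 < α) (γ : ℝ) {x : ℝ} (hx : 0 < x)
    (k : ℝ → ℝ≥0∞) :
    ∫⁻ t in Ioi 0, ENNReal.ofReal ((t + 1) ^ (-(γ / α)))
        * logTest α k ((t + 1) ^ α⁻¹ * x)
      = ENNReal.ofReal (α * Real.exp ((γ - α) * Real.log x)) *
        ∫⁻ y in Ioi (Real.log x), ENNReal.ofReal (Real.exp (-γ * y)) * k y := by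
  set L := Real.log x with hL
  have himg : (fun y => Real.exp (α * (y - L)) - 1) '' Ioi L = Ioi 0 := by
    ext t
    simp only [mem_image, mem_Ioi]
    constructor
    · rintro ⟨y, hy, rfl⟩
      have := Real.one_lt_exp_iff.2 (mul_pos hα (sub_pos.2 hy))
      linarith
    · intro ht
      refine ⟨L + Real.log (t + 1) / α, ?_, ?_⟩
      · have := div_pos (Real.log_pos (by linarith : 1 < t + 1)) hα
        linarith
      · rw [add_sub_cancel_left, mul_div_cancel₀ _ hα.ne', Real.exp_log (by linarith)]
        ring
  have hinj : InjOn (fun y => Real.exp (α * (y - L)) - 1) (Ioi L) := by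
    intro y _ z _ hyz
    have h := Real.exp_injective (sub_left_injective hyz)
    linarith [mul_left_cancel₀ hα.ne' h]
  have hderiv : ∀ y ∈ Ioi L, HasDerivWithinAt (fun y => Real.exp (α * (y - L)) - 1)
      (Real.exp (α * (y - L)) * α) (Ioi L) y := by
    intro y _
    have h : HasDerivAt (fun y => α * (y - L)) α y := by
      simpa using ((hasDerivAt_id y).sub_const L).const_mul α
    exact (h.exp.sub_const 1).hasDerivWithinAt
  rw [← himg, lintegral_image_eq_lintegral_abs_deriv_mul measurableSet_Ioi hderiv hinj,
    ← lintegral_const_mul' _ _ ENNReal.ofReal_ne_top]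
  refine lintegral_congr fun y => ?_
  have hlog : Real.log (Real.exp (y - L) * x) = y := by
    rw [Real.log_mul (Real.exp_pos _).ne' hx.ne', Real.log_exp, ← hL]
    ring
  have hroot : Real.exp (α * (y - L)) ^ α⁻¹ = Real.exp (y - L) := by
    rw [← Real.exp_mul, mul_right_comm, mul_inv_cancel₀ hα.ne', one_mul]
  have hpow : Real.exp (α * (y - L)) ^ (-(γ / α)) = Real.exp (-γ * (y - L)) := by
    rw [← Real.exp_mul]
    congr 1
    field_simp
  rw [sub_add_cancel, hroot, hpow, logTest, hlog, abs_of_pos (by positivity), ← mul_assoc,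
    ← mul_assoc, ← mul_assoc, ← ENNReal.ofReal_mul (by positivity),
    ← ENNReal.ofReal_mul (by positivity), ← ENNReal.ofReal_mul (by positivity)]
  congr 2
  rw [mul_comm _ α, mul_assoc α, mul_assoc α, mul_assoc α, ← Real.exp_add, ← Real.exp_add,
    ← Real.exp_add]
  congr 2
  ring

end Lamperti

section EntranceLaw

variable [MeasurableSpace Ω] {P : Measure Ω} {ξ : ℝ → Ω → ℝ} {ζ : Ω → ℝ≥0∞} {α γ : ℝ}

/-- The potential of an entrance law, computed through Lamperti's transformation on one side and
through the scaling property on the other. -/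
lemma lintegral_potential_entranceLaw [IsProbabilityMeasure P] (hα : 0 < α)
    (hL : IsKilledLevy P ξ ζ) (hHit : ∀ᵐ ω ∂P, expFunctional α ξ ζ ω < ⊤) {η : ℝ → Measure ℝ}
    (hη : IsSSEL α γ (lampertiSemigroup α ξ ζ P) η) {k : ℝ → ℝ≥0∞} (hk : Measurable k) :
    ∫⁻ x, (∫⁻ s in Ioi 0, ∫⁻ y, k (Real.log x + y) ∂(stateLaw P ξ ζ s)) ∂(η 1)
      = ∫⁻ x, (ENNReal.ofReal (α * Real.exp ((γ - α) * Real.log x)) *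
          ∫⁻ y in Ioi (Real.log x), ENNReal.ofReal (Real.exp (-γ * y)) * k y) ∂(η 1) := by
  obtain ⟨hσ, hsupp, hEL, hscale⟩ := hη
  have := hσ 1 one_pos
  have hξ := hL.1
  have hζ := hL.2.1
  have hpos : ∀ᵐ x ∂(η 1), 0 < x := by
    have h : {x : ℝ | ¬ 0 < x} = Iic 0 := by ext; simp
    rw [ae_iff, h]
    exact hsupp 1 one_pos
  have hf := measurable_logTest α hk
  have hm : Measurable fun p : ℝ × ℝ =>
      ∫⁻ y, logTest α k y ∂(lampertiSemigroup α ξ ζ P p.2 p.1) := by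
    simp_rw [lintegral_lampertiSemigroup hξ hζ α _ _ hf]
    refine Measurable.lintegral_prod_right' (f := fun p : (ℝ × ℝ) × Ω =>
      lampertiValue α ξ ζ (logTest α k) p.1.1 (p.1.2 / p.1.1 ^ α) p.2) ?_
    exact (measurable_lampertiValue hξ hζ α hf).comp
      ((measurable_fst.fst.prodMk (measurable_fst.snd.div
        (measurable_fst.fst.pow_const α))).prodMk measurable_snd)
  have hm' : Measurable fun p : ℝ × ℝ => ENNReal.ofReal ((p.1 + 1) ^ (-(γ / α)))
      * logTest α k ((p.1 + 1) ^ α⁻¹ * p.2) :=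
    (ENNReal.measurable_ofReal.comp ((measurable_fst.add_const 1).pow_const _)).mul
      (hf.comp (((measurable_fst.add_const 1).pow_const _).mul measurable_snd))
  calc ∫⁻ x, (∫⁻ s in Ioi 0, ∫⁻ y, k (Real.log x + y) ∂(stateLaw P ξ ζ s)) ∂(η 1)
      = ∫⁻ x, (∫⁻ t in Ioi 0, ∫⁻ y, logTest α k y ∂(lampertiSemigroup α ξ ζ P t x)) ∂(η 1) :=
        lintegral_congr_ae (hpos.mono fun x hx =>
          (lintegral_lampertiSemigroup_logTest hξ hζ hHit hx hk).symm)
    _ = ∫⁻ t in Ioi 0, ∫⁻ x, (∫⁻ y, logTest α k y ∂(lampertiSemigroup α ξ ζ P t x)) ∂(η 1) :=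
        lintegral_lintegral_swap hm.aemeasurable
    _ = ∫⁻ t in Ioi 0, ∫⁻ x, ENNReal.ofReal ((t + 1) ^ (-(γ / α)))
          * logTest α k ((t + 1) ^ α⁻¹ * x) ∂(η 1) := by
        refine setLIntegral_congr_fun measurableSet_Ioi fun t ht => ?_
        have ht' : (0 : ℝ) < t := ht
        rw [hEL 1 one_pos t ht'.le _ hf, hscale (t + 1) (by linarith) _ hf,
          lintegral_const_mul' _ _ ENNReal.ofReal_ne_top]
    _ = ∫⁻ x, (∫⁻ t in Ioi 0, ENNReal.ofReal ((t + 1) ^ (-(γ / α)))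
          * logTest α k ((t + 1) ^ α⁻¹ * x)) ∂(η 1) :=
        lintegral_lintegral_swap hm'.aemeasurable
    _ = _ := lintegral_congr_ae (hpos.mono fun x hx => lintegral_scaling_logTest hα γ hx k)

/-- The function `z ↦ α ∫ x^{γ-α} 1_{log x < z} η(dx)`. -/
def truncMoment (α γ : ℝ) (η : Measure ℝ) (z : ℝ) : ℝ≥0∞ :=
  ∫⁻ x in {x | Real.log x < z}, ENNReal.ofReal (α * Real.exp ((γ - α) * Real.log x)) ∂η

lemma measurableSet_log_lt (z : ℝ) : MeasurableSet {x : ℝ | Real.log x < z} :=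
  measurableSet_lt Real.measurable_log measurable_const

lemma measurable_ofReal_exp_log (c : ℝ) (δ : ℝ) :
    Measurable fun x : ℝ => ENNReal.ofReal (c * Real.exp (δ * Real.log x)) :=
  ENNReal.measurable_ofReal.comp
    ((Real.measurable_exp.comp (Real.measurable_log.const_mul δ)).const_mul c)

lemma measurable_ofReal_exp_mul (δ : ℝ) :
    Measurable fun x : ℝ => ENNReal.ofReal (Real.exp (δ * x)) :=
  ENNReal.measurable_ofReal.comp (Real.measurable_exp.comp (measurable_const_mul δ))

lemma measurable_ofReal_exp_mul_mul (δ : ℝ) {k : ℝ → ℝ≥0∞} (hk : Measurable k) :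
    Measurable fun x => ENNReal.ofReal (Real.exp (δ * x)) * k x :=
  (measurable_ofReal_exp_mul δ).mul hk

lemma truncMoment_mono (η : Measure ℝ) : Monotone (truncMoment α γ η) := fun _ _ h =>
  lintegral_mono_set fun _ hx => lt_of_lt_of_le hx h

lemma iSup_truncMoment_sub (η : Measure ℝ) (b : ℝ) :
    ⨆ n : ℕ, truncMoment α γ η (n - b)
      = ∫⁻ x, ENNReal.ofReal (α * Real.exp ((γ - α) * Real.log x)) ∂η := by
  unfold truncMoment
  have huniv : ⋃ n : ℕ, {x : ℝ | Real.log x < n - b} = univ := by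
    refine eq_univ_of_forall fun x => mem_iUnion.2 ?_
    obtain ⟨n, hn⟩ := exists_nat_gt (Real.log x + b)
    exact ⟨n, lt_sub_iff_add_lt.2 hn⟩
  rw [← setLIntegral_iUnion_of_directed, huniv, Measure.restrict_univ]
  · refine directed_of_isDirected_le fun m n hmn x (hx : Real.log x < m - b) => ?_
    exact hx.trans_le (sub_le_sub_right (Nat.cast_le.2 hmn) b)

lemma lintegral_mul_setLIntegral_Ioi_log (η : Measure ℝ) [SFinite η] {k : ℝ → ℝ≥0∞}
    (hk : Measurable k) :
    ∫⁻ x, (ENNReal.ofReal (α * Real.exp ((γ - α) * Real.log x)) *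
        ∫⁻ y in Ioi (Real.log x), k y) ∂η = ∫⁻ y, truncMoment α γ η y * k y := by
  have hset : MeasurableSet {p : ℝ × ℝ | Real.log p.1 < p.2} :=
    measurableSet_lt (Real.measurable_log.comp measurable_fst) measurable_snd
  have hm : Measurable fun p : ℝ × ℝ => {p : ℝ × ℝ | Real.log p.1 < p.2}.indicator
      (fun p => ENNReal.ofReal (α * Real.exp ((γ - α) * Real.log p.1)) * k p.2) p :=
    (((measurable_ofReal_exp_log α (γ - α)).comp measurable_fst).mul
      (hk.comp measurable_snd)).indicator hset
  calc _ = ∫⁻ x, (∫⁻ y, {p : ℝ × ℝ | Real.log p.1 < p.2}.indicator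
        (fun p => ENNReal.ofReal (α * Real.exp ((γ - α) * Real.log p.1)) * k p.2) (x, y)) ∂η := by
        refine lintegral_congr fun x => ?_
        rw [← lintegral_const_mul' _ _ ENNReal.ofReal_ne_top,
          ← lintegral_indicator measurableSet_Ioi]
        rfl
    _ = ∫⁻ y, ∫⁻ x, {p : ℝ × ℝ | Real.log p.1 < p.2}.indicator
        (fun p => ENNReal.ofReal (α * Real.exp ((γ - α) * Real.log p.1)) * k p.2) (x, y) ∂η :=
        lintegral_lintegral_swap hm.aemeasurable
    _ = _ := by
        refine lintegral_congr fun y => ?_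
        rw [truncMoment, ← lintegral_mul_const _ (measurable_ofReal_exp_log _ _),
          ← lintegral_indicator (measurableSet_log_lt y)]
        rfl

lemma setLIntegral_Ioi_add_one_le (g : ℝ → ℝ≥0∞) :
    ∫⁻ s in Ioi 0, g (s + 1) ≤ ∫⁻ s in Ioi 0, g s := by
  rw [← lintegral_indicator measurableSet_Ioi, ← lintegral_indicator measurableSet_Ioi,
    ← lintegral_add_right_eq_self ((Ioi 0).indicator g) (1 : ℝ)]
  refine lintegral_mono fun s => ?_
  by_cases hs : s ∈ Ioi (0 : ℝ)
  · have hs1 : s + 1 ∈ Ioi (0 : ℝ) := add_pos (mem_Ioi.1 hs) one_pos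
    rw [indicator_of_mem hs, indicator_of_mem hs1]
  · simp [indicator_of_notMem hs]

/-- The measure `e^{-γy} truncMoment(y) dy` is excessive for the killed Lévy process. -/
lemma lintegral_truncMoment_stateLaw_one_le [IsProbabilityMeasure P] (hα : 0 < α)
    (hL : IsKilledLevy P ξ ζ) (hHit : ∀ᵐ ω ∂P, expFunctional α ξ ζ ω < ⊤) {η : ℝ → Measure ℝ}
    (hη : IsSSEL α γ (lampertiSemigroup α ξ ζ P) η) {k : ℝ → ℝ≥0∞} (hk : Measurable k) :
    ∫⁻ y, truncMoment α γ (η 1) y * (ENNReal.ofReal (Real.exp (-γ * y)) *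
        ∫⁻ b, k (y + b) ∂(stateLaw P ξ ζ 1))
      ≤ ∫⁻ y, truncMoment α γ (η 1) y * (ENNReal.ofReal (Real.exp (-γ * y)) * k y) := by
  have := hη.1 1 one_pos
  have hk2 : Measurable fun p : ℝ × ℝ => k (p.1 + p.2) := hk.comp measurable_add
  have hP : Measurable fun y => ∫⁻ b, k (y + b) ∂(stateLaw P ξ ζ 1) :=
    hk2.lintegral_prod_right'
  rw [← lintegral_mul_setLIntegral_Ioi_log (η 1) (measurable_ofReal_exp_mul_mul _ hP),
    ← lintegral_mul_setLIntegral_Ioi_log (η 1) (measurable_ofReal_exp_mul_mul _ hk),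
    ← lintegral_potential_entranceLaw hα hL hHit hη hk,
    ← lintegral_potential_entranceLaw hα hL hHit hη hP]
  refine lintegral_mono fun x => ?_
  refine le_trans (le_of_eq ?_) (setLIntegral_Ioi_add_one_le fun s =>
    ∫⁻ y, k (Real.log x + y) ∂(stateLaw P ξ ζ s))
  refine setLIntegral_congr_fun measurableSet_Ioi fun s hs => ?_
  simp only [add_assoc]
  exact (lintegral_stateLaw_add hL (le_of_lt hs) zero_le_one
    (hk.comp (measurable_const_add (Real.log x)))).symm

/-- The Esscher moment at `γ` is at most one as soon as `η 1` integrates `x^{γ-α}`. -/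
lemma lintegral_exp_stateLaw_one_le [IsProbabilityMeasure P] (hα : 0 < α)
    (hL : IsKilledLevy P ξ ζ) (hHit : ∀ᵐ ω ∂P, expFunctional α ξ ζ ω < ⊤) {η : ℝ → Measure ℝ}
    (hη : IsSSEL α γ (lampertiSemigroup α ξ ζ P) η) (hη1 : η 1 ≠ 0)
    (hfin : ∫⁻ x, ENNReal.ofReal (α * Real.exp ((γ - α) * Real.log x)) ∂(η 1) ≠ ⊤) :
    ∫⁻ y, ENNReal.ofReal (Real.exp (γ * y)) ∂(stateLaw P ξ ζ 1) ≤ 1 := by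
  set c := ∫⁻ x, ENNReal.ofReal (α * Real.exp ((γ - α) * Real.log x)) ∂(η 1) with hc
  set F := truncMoment α γ (η 1) with hF
  have hFmono : Monotone F := truncMoment_mono (η 1)
  have hFc : ∀ z, F z ≤ c := fun z => setLIntegral_le_lintegral _ _
  have hc0 : c ≠ 0 := by
    intro h0
    rw [hc, lintegral_eq_zero_iff (measurable_ofReal_exp_log _ _)] at h0
    refine hη1 (Measure.measure_univ_eq_zero.1 ?_)
    refine measure_mono_null (fun x _ => ?_) (ae_iff.1 h0)
    simp only [Pi.zero_apply, ENNReal.ofReal_eq_zero, mem_ofPred_eq, not_le]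
    positivity
  have hstep : ∀ n : ℕ, ∫⁻ b, ENNReal.ofReal (Real.exp (γ * b)) * F (n - b)
      ∂(stateLaw P ξ ζ 1) ≤ c := by
    intro n
    set B : Set ℝ := Ico n (n + 1) with hB
    have hBm : MeasurableSet B := measurableSet_Ico
    set κ : ℝ≥0∞ := ∫⁻ y in B, ENNReal.ofReal (Real.exp (-γ * y)) with hκ
    have hκ0 : κ ≠ 0 := by
      rw [hκ, Ne, lintegral_eq_zero_iff (measurable_ofReal_exp_mul _)]
      intro h0
      have h1 : (volume.restrict B) univ = 0 := by
        refine measure_mono_null (fun y _ => ?_) (ae_iff.1 h0)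
        simp only [Pi.zero_apply, ENNReal.ofReal_eq_zero, mem_ofPred_eq, not_le]
        positivity
      simp [hB] at h1
    have hκtop : κ ≠ ⊤ := by
      have hcont : ContinuousOn (fun y : ℝ => Real.exp (-γ * y)) (Icc n (n + 1)) := by fun_prop
      have hint : IntegrableOn (fun y : ℝ => Real.exp (-γ * y)) B :=
        hcont.integrableOn_Icc.mono_set Ico_subset_Icc_self
      exact hint.lintegral_lt_top.ne
    have hkm : Measurable (B.indicator (1 : ℝ → ℝ≥0∞)) := measurable_one.indicator hBm
    have hk2 : Measurable fun p : ℝ × ℝ => B.indicator (1 : ℝ → ℝ≥0∞) (p.1 + p.2) :=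
      hkm.comp measurable_add
    have hFm : Measurable F := hFmono.measurable
    have hex := lintegral_truncMoment_stateLaw_one_le hα hL hHit hη hkm
    have hright : ∫⁻ y, F y * (ENNReal.ofReal (Real.exp (-γ * y)) * B.indicator 1 y)
        ≤ c * κ := by
      calc _ ≤ ∫⁻ y, c * (ENNReal.ofReal (Real.exp (-γ * y)) * B.indicator 1 y) := by
            gcongr with y; exact hFc y
        _ = c * κ := by
            rw [lintegral_const_mul _ (measurable_ofReal_exp_mul_mul _ hkm), hκ,
              ← lintegral_indicator hBm]
            congr 1
            refine lintegral_congr fun y => ?_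
            by_cases hy : y ∈ B <;> simp [hy]
    have hleft : (∫⁻ b, ENNReal.ofReal (Real.exp (γ * b)) * F (n - b) ∂(stateLaw P ξ ζ 1)) * κ
        ≤ ∫⁻ y, F y * (ENNReal.ofReal (Real.exp (-γ * y)) *
            ∫⁻ b, B.indicator 1 (y + b) ∂(stateLaw P ξ ζ 1)) := by
      have hH : Measurable fun p : ℝ × ℝ => F p.1 * (ENNReal.ofReal (Real.exp (-γ * p.1)) *
          B.indicator (1 : ℝ → ℝ≥0∞) (p.1 + p.2)) :=
        (hFm.comp measurable_fst).mul
          (((measurable_ofReal_exp_mul _).comp measurable_fst).mul hk2)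
      have hm1 : Measurable fun b => ENNReal.ofReal (Real.exp (γ * b)) * F (n - b) :=
        (measurable_ofReal_exp_mul γ).mul (hFm.comp (measurable_const.sub measurable_id))
      calc _ = ∫⁻ b, ENNReal.ofReal (Real.exp (γ * b)) * F (n - b) * κ ∂(stateLaw P ξ ζ 1) :=
            (lintegral_mul_const _ hm1).symm
        _ ≤ ∫⁻ b, (∫⁻ y, F y * (ENNReal.ofReal (Real.exp (-γ * y)) *
              B.indicator 1 (y + b))) ∂(stateLaw P ξ ζ 1) := by
            refine lintegral_mono fun b => ?_
            rw [← lintegral_sub_right_eq_self (fun y => F y *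
              (ENNReal.ofReal (Real.exp (-γ * y)) * B.indicator 1 (y + b))) b, hκ,
              ← lintegral_const_mul _ (measurable_ofReal_exp_mul _),
              ← lintegral_indicator hBm]
            refine lintegral_mono fun y => ?_
            by_cases hy : y ∈ B
            · simp only [indicator_of_mem hy, sub_add_cancel, Pi.one_apply, mul_one]
              rw [mul_right_comm, ← ENNReal.ofReal_mul (Real.exp_pos _).le, ← Real.exp_add,
                mul_comm (F (y - b))]
              have hexp : γ * b + -γ * y = -γ * (y - b) := by ring
              rw [hexp]
              gcongr
              exact hFmono (sub_le_sub_right hy.1 b)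
            · simp [hy]
        _ = ∫⁻ y, ∫⁻ b, F y * (ENNReal.ofReal (Real.exp (-γ * y)) *
              B.indicator 1 (y + b)) ∂(stateLaw P ξ ζ 1) :=
            lintegral_lintegral_swap (hH.comp measurable_swap).aemeasurable
        _ = _ := by
            refine lintegral_congr fun y => ?_
            have hkb : Measurable fun b => B.indicator (1 : ℝ → ℝ≥0∞) (y + b) :=
              hkm.comp (measurable_const_add y)
            rw [lintegral_const_mul _ (hkb.const_mul _), lintegral_const_mul _ hkb]
    exact (ENNReal.mul_le_mul_iff_left hκ0 hκtop).1 (hleft.trans (hex.trans hright))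
  have hlim : (∫⁻ y, ENNReal.ofReal (Real.exp (γ * y)) ∂(stateLaw P ξ ζ 1)) * c ≤ c := by
    calc _ = ∫⁻ b, ⨆ n : ℕ, ENNReal.ofReal (Real.exp (γ * b)) * F (n - b)
          ∂(stateLaw P ξ ζ 1) := by
          rw [← lintegral_mul_const _ (measurable_ofReal_exp_mul γ)]
          refine lintegral_congr fun b => ?_
          rw [← ENNReal.mul_iSup, hF, iSup_truncMoment_sub]
      _ = ⨆ n : ℕ, ∫⁻ b, ENNReal.ofReal (Real.exp (γ * b)) * F (n - b)
          ∂(stateLaw P ξ ζ 1) := by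
          refine lintegral_iSup (fun n => (measurable_ofReal_exp_mul γ).mul
            (hFmono.measurable.comp (measurable_const.sub measurable_id)))
            fun m n hmn b => ?_
          dsimp only
          gcongr
          exact hFmono (sub_le_sub_right (Nat.cast_le.2 hmn) b)
      _ ≤ c := iSup_le hstep
  rw [← ENNReal.mul_le_mul_iff_left hc0 hfin, one_mul]
  exact hlim

lemma lintegral_exp_potential_ne_zero [IsProbabilityMeasure P] (hL : IsKilledLevy P ξ ζ)
    (h1 : stateLaw P ξ ζ 1 ≠ 0) (θ : ℝ) :
    ∫⁻ s in Ioi 0, ∫⁻ y, ENNReal.ofReal (Real.exp (θ * y)) ∂(stateLaw P ξ ζ s) ≠ 0 := by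
  have hξ := hL.1
  have hζ := hL.2.1
  have hm : Measurable fun s => ∫⁻ y, ENNReal.ofReal (Real.exp (θ * y)) ∂(stateLaw P ξ ζ s) :=
    measurable_lintegral_stateLaw hξ hζ (φ := fun _ y => ENNReal.ofReal (Real.exp (θ * y)))
      ((measurable_ofReal_exp_mul θ).comp measurable_snd) measurable_id
  have hpos : ∀ s ≤ 1, ∫⁻ y, ENNReal.ofReal (Real.exp (θ * y)) ∂(stateLaw P ξ ζ s) ≠ 0 := by
    intro s hs h0
    rw [lintegral_eq_zero_iff (measurable_ofReal_exp_mul θ)] at h0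
    have huniv : stateLaw P ξ ζ s univ = 0 := by
      refine measure_mono_null (fun y _ => ?_) (ae_iff.1 h0)
      simp only [Pi.zero_apply, ENNReal.ofReal_eq_zero, mem_ofPred_eq, not_le]
      positivity
    refine h1 (Measure.measure_univ_eq_zero.1 (le_antisymm ?_ zero_le))
    rw [← huniv, stateLaw, stateLaw, Measure.map_apply hξ.of_uncurry_left MeasurableSet.univ,
      Measure.map_apply hξ.of_uncurry_left MeasurableSet.univ]
    simp only [preimage_univ, Measure.restrict_apply_univ]
    exact measure_mono fun ω hω => (ENNReal.ofReal_le_ofReal hs).trans_lt hω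
  intro h0
  rw [lintegral_eq_zero_iff hm, EventuallyEq, ae_iff] at h0
  have hsub : Ioc (0 : ℝ) 1 ⊆ {s | ¬ ∫⁻ y, ENNReal.ofReal (Real.exp (θ * y))
      ∂(stateLaw P ξ ζ s) = (0 : ℝ → ℝ≥0∞) s} := fun s hs => hpos s hs.2
  have h2 := measure_mono_null hsub h0
  rw [Measure.restrict_apply measurableSet_Ioc,
    inter_eq_left.2 (Ioc_subset_Ioi_self : Ioc (0 : ℝ) 1 ⊆ Ioi 0)] at h2
  simp at h2

/-- Finiteness of the moment of order `θ - α` of `η 1` propagates to order `θ < γ`. -/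
lemma lintegral_exp_log_ne_top_step [IsProbabilityMeasure P] (hα : 0 < α)
    (hL : IsKilledLevy P ξ ζ) (hHit : ∀ᵐ ω ∂P, expFunctional α ξ ζ ω < ⊤) {η : ℝ → Measure ℝ}
    (hη : IsSSEL α γ (lampertiSemigroup α ξ ζ P) η) (h1 : stateLaw P ξ ζ 1 ≠ 0) {θ : ℝ}
    (hθ : θ < γ) (hfin : ∫⁻ x, ENNReal.ofReal (Real.exp ((θ - α) * Real.log x)) ∂(η 1) ≠ ⊤) :
    ∫⁻ x, ENNReal.ofReal (Real.exp (θ * Real.log x)) ∂(η 1) ≠ ⊤ := by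
  have h := lintegral_potential_entranceLaw hα hL hHit hη (measurable_ofReal_exp_mul θ)
  set κ := ∫⁻ s in Ioi 0, ∫⁻ y, ENNReal.ofReal (Real.exp (θ * y)) ∂(stateLaw P ξ ζ s) with hκ
  have hκ0 : κ ≠ 0 := lintegral_exp_potential_ne_zero hL h1 θ
  have hmexp : Measurable fun x : ℝ => ENNReal.ofReal (Real.exp (θ * Real.log x)) := by
    simpa using measurable_ofReal_exp_log 1 θ
  have hleft : ∀ x, ∫⁻ s in Ioi 0, ∫⁻ y, ENNReal.ofReal (Real.exp (θ * (Real.log x + y)))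
      ∂(stateLaw P ξ ζ s) = ENNReal.ofReal (Real.exp (θ * Real.log x)) * κ := by
    intro x
    simp_rw [mul_add, Real.exp_add, ENNReal.ofReal_mul (Real.exp_pos _).le,
      lintegral_const_mul' _ _ ENNReal.ofReal_ne_top]
    rfl
  have hright : ∀ x, ENNReal.ofReal (α * Real.exp ((γ - α) * Real.log x)) *
      ∫⁻ y in Ioi (Real.log x), ENNReal.ofReal (Real.exp (-γ * y)) *
        ENNReal.ofReal (Real.exp (θ * y))
      = ENNReal.ofReal (α / (γ - θ)) * ENNReal.ofReal (Real.exp ((θ - α) * Real.log x)) := by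
    intro x
    have hneg : θ - γ < 0 := sub_neg.2 hθ
    have hint : ∫⁻ y in Ioi (Real.log x), ENNReal.ofReal (Real.exp (-γ * y)) *
        ENNReal.ofReal (Real.exp (θ * y))
        = ENNReal.ofReal (Real.exp ((θ - γ) * Real.log x) / (γ - θ)) := by
      rw [show Real.exp ((θ - γ) * Real.log x) / (γ - θ)
        = ∫ y in Ioi (Real.log x), Real.exp ((θ - γ) * y) by
          rw [integral_exp_mul_Ioi hneg, ← neg_sub θ γ, div_neg, neg_div],
        ofReal_integral_eq_lintegral_ofReal (integrableOn_exp_mul_Ioi hneg _)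
          (ae_of_all _ fun y => (Real.exp_pos _).le)]
      refine lintegral_congr fun y => ?_
      rw [← ENNReal.ofReal_mul (Real.exp_pos _).le, ← Real.exp_add]
      ring_nf
    rw [hint, ← ENNReal.ofReal_mul (by positivity),
      ← ENNReal.ofReal_mul (div_nonneg hα.le (sub_pos.2 hθ).le)]
    congr 1
    rw [show (θ - α) * Real.log x = (γ - α) * Real.log x + (θ - γ) * Real.log x by ring,
      Real.exp_add]
    ring
  simp_rw [hleft, hright] at h
  rw [lintegral_mul_const _ hmexp, lintegral_const_mul' _ _ ENNReal.ofReal_ne_top] at h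
  intro htop
  rw [htop, ENNReal.top_mul hκ0] at h
  exact ENNReal.mul_ne_top ENNReal.ofReal_ne_top hfin h.symm

/-- `η 1` has finite moments of all orders in `[0, γ)` when `α < γ`. -/
lemma lintegral_exp_log_ne_top [IsProbabilityMeasure P] (hα : 0 < α) (hαγ : α < γ)
    (hL : IsKilledLevy P ξ ζ) (hHit : ∀ᵐ ω ∂P, expFunctional α ξ ζ ω < ⊤) {η : ℝ → Measure ℝ}
    (hη : IsSSEL α γ (lampertiSemigroup α ξ ζ P) η) [IsFiniteMeasure (η 1)]
    (h1 : stateLaw P ξ ζ 1 ≠ 0) (n : ℕ) :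
    ∀ β : ℝ, 0 ≤ β → β < γ → β ≤ (n + 1) * α →
      ∫⁻ x, ENNReal.ofReal (Real.exp (β * Real.log x)) ∂(η 1) ≠ ⊤ := by
  have hsmall : ∀ β : ℝ, 0 ≤ β → β ≤ α →
      ∫⁻ x, ENNReal.ofReal (Real.exp (β * Real.log x)) ∂(η 1) ≠ ⊤ := by
    intro β hβ0 hβα
    have hone : ∫⁻ x, ENNReal.ofReal (Real.exp (α * Real.log x)) ∂(η 1) ≠ ⊤ := by
      refine lintegral_exp_log_ne_top_step hα hL hHit hη h1 hαγ ?_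
      simp
    refine ne_top_of_le_ne_top (b := ∫⁻ x, (1 + ENNReal.ofReal (Real.exp (α * Real.log x)))
      ∂(η 1)) ?_ (lintegral_mono fun x => ?_)
    · rw [lintegral_add_left measurable_const]
      exact ENNReal.add_ne_top.2 ⟨by simp, hone⟩
    · dsimp only
      rcases le_total (Real.log x) 0 with hx | hx
      · refine le_add_right ?_
        rw [← ENNReal.ofReal_one]
        exact ENNReal.ofReal_le_ofReal
          (Real.exp_le_one_iff.2 (mul_nonpos_of_nonneg_of_nonpos hβ0 hx))
      · refine le_add_left ?_
        gcongr
  induction n with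
  | zero => exact fun β hβ0 _ hβ => hsmall β hβ0 (by simpa using hβ)
  | succ n ih =>
    intro β hβ0 hβγ hβ
    rcases le_total β α with hβα | hβα
    · exact hsmall β hβ0 hβα
    · refine lintegral_exp_log_ne_top_step hα hL hHit hη h1 hβγ
        (ih (β - α) (sub_nonneg.2 hβα) (by linarith) ?_)
      push_cast at hβ
      linarith

/-- When `γ < α`, transience of `ξ` makes the moment of order `γ - α` of `η 1` finite. -/
lemma lintegral_exp_log_ne_top_of_lt [IsProbabilityMeasure P] (hα : 0 < α) (hγα : γ < α)
    (hL : IsKilledLevy P ξ ζ) (hHit : ∀ᵐ ω ∂P, expFunctional α ξ ζ ω < ⊤) {η : ℝ → Measure ℝ}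
    (hη : IsSSEL α γ (lampertiSemigroup α ξ ζ P) η) [IsProbabilityMeasure (η 1)]
    (hγ : 0 < γ) :
    ∫⁻ x, ENNReal.ofReal (α * Real.exp ((γ - α) * Real.log x)) ∂(η 1) ≠ ⊤ := by
  obtain ⟨C, hC, hpot⟩ := exists_potential_Ico_le hα hL hHit
  set k : ℝ → ℝ≥0∞ := (Ico 0 1).indicator 1 with hk
  have hkm : Measurable k := measurable_one.indicator measurableSet_Ico
  have h := lintegral_potential_entranceLaw hα hL hHit hη hkm
  have hle :
      ∫⁻ x, (∫⁻ s in Ioi 0, ∫⁻ y, k (Real.log x + y) ∂(stateLaw P ξ ζ s)) ∂(η 1) ≤ C := by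
    calc _ ≤ ∫⁻ _, C ∂(η 1) := by
          refine lintegral_mono fun x => le_trans (le_of_eq ?_) (hpot (-Real.log x))
          refine lintegral_congr fun s => ?_
          rw [← lintegral_indicator_one measurableSet_Ico]
          refine lintegral_congr fun y => ?_
          simp only [hk, indicator, mem_Ico]
          congr 1
          exact propext ⟨fun hy => ⟨by linarith [hy.1], by linarith [hy.2]⟩,
            fun hy => ⟨by linarith [hy.1], by linarith [hy.2]⟩⟩
      _ = C := by simp
  rw [h, lintegral_mul_setLIntegral_Ioi_log (η 1)
    (measurable_ofReal_exp_mul_mul (-γ) hkm)] at hle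
  have hF0 : truncMoment α γ (η 1) 0 ≠ ⊤ := by
    have hle2 : truncMoment α γ (η 1) 0 * ENNReal.ofReal (Real.exp (-γ)) ≤ C := by
      refine le_trans ?_ hle
      calc truncMoment α γ (η 1) 0 * ENNReal.ofReal (Real.exp (-γ))
          = ∫⁻ _ in Ico (0 : ℝ) 1, truncMoment α γ (η 1) 0 * ENNReal.ofReal (Real.exp (-γ)) := by
            simp
        _ ≤ _ := by
            rw [← lintegral_indicator measurableSet_Ico]
            refine lintegral_mono fun y => ?_
            by_cases hy : y ∈ Ico (0 : ℝ) 1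
            · simp only [hk, indicator_of_mem hy, Pi.one_apply, mul_one]
              refine mul_le_mul' (truncMoment_mono _ hy.1)
                (ENNReal.ofReal_le_ofReal (Real.exp_le_exp.2 ?_))
              nlinarith [hy.2]
            · simp [hy]
    intro htop
    rw [htop, ENNReal.top_mul (by simp [Real.exp_pos])] at hle2
    exact hC (top_le_iff.1 hle2)
  rw [← lintegral_add_compl _ (measurableSet_log_lt 0)]
  refine ENNReal.add_ne_top.2 ⟨hF0, ne_top_of_le_ne_top (b := ENNReal.ofReal α) (by simp) ?_⟩
  calc _ ≤ ∫⁻ _ in {x | Real.log x < 0}ᶜ, ENNReal.ofReal α ∂(η 1) := by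
        refine setLIntegral_mono' (measurableSet_log_lt 0).compl fun x hx => ?_
        have hx0 : 0 ≤ Real.log x := not_lt.1 hx
        exact ENNReal.ofReal_le_ofReal (mul_le_of_le_one_right hα.le
          (Real.exp_le_one_iff.2 (mul_nonpos_of_nonpos_of_nonneg (sub_neg.2 hγα).le hx0)))
    _ ≤ ∫⁻ _, ENNReal.ofReal α ∂(η 1) := setLIntegral_le_lintegral _ _
    _ = ENNReal.ofReal α := by simp

end EntranceLaw

/-- Theorem 1.1, (iii) ⇒ (i): let `X` be the `1/α`-pssMp associated via Lamperti's
transformation to the killed Lévy process `ξ`, assumed to hit `0` in finite time a.s.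
If for `γ > 0` there exists a `γ`-self-similar entrance law `(η_t)_{t>0}` for `X` such that
`η_1` is a probability measure, then `E[e^{γ ξ_1}, 1 < ζ] ≤ 1`. -/
theorem thm1_1_iii_implies_i {Ω : Type*} [MeasurableSpace Ω]
    (P : Measure Ω) [IsProbabilityMeasure P] (ξ : ℝ → Ω → ℝ) (ζ : Ω → ℝ≥0∞)
    (α γ : ℝ) (hα : 0 < α) (hγ : 0 < γ)
    (hLevy : IsKilledLevy P ξ ζ)
    (hHit : ∀ᵐ ω ∂P, expFunctional α ξ ζ ω < ⊤)
    (hex : ∃ η : ℝ → Measure ℝ,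
      IsSSEL α γ (lampertiSemigroup α ξ ζ P) η ∧ IsProbabilityMeasure (η 1)) :
    ∫⁻ ω, {ω : Ω | 1 < ζ ω}.indicator
        (fun ω => ENNReal.ofReal (Real.exp (γ * ξ 1 ω))) ω ∂P ≤ 1 := by
  obtain ⟨η, hη, hprob⟩ := hex
  have hgoal : ∫⁻ ω, {ω : Ω | 1 < ζ ω}.indicator
      (fun ω => ENNReal.ofReal (Real.exp (γ * ξ 1 ω))) ω ∂P
      = ∫⁻ y, ENNReal.ofReal (Real.exp (γ * y)) ∂(stateLaw P ξ ζ 1) := by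
    rw [lintegral_stateLaw hLevy.1 hLevy.2.1 1 (measurable_ofReal_exp_mul γ),
      ENNReal.ofReal_one]
  rw [hgoal]
  by_cases h1 : stateLaw P ξ ζ 1 = 0
  · simp [h1]
  refine lintegral_exp_stateLaw_one_le hα hLevy hHit hη (IsProbabilityMeasure.ne_zero _) ?_
  rcases lt_or_ge γ α with hγα | hαγ
  · exact lintegral_exp_log_ne_top_of_lt hα hγα hLevy hHit hη hγ
  · simp_rw [ENNReal.ofReal_mul hα.le]
    rw [lintegral_const_mul' _ _ ENNReal.ofReal_ne_top]
    refine ENNReal.mul_ne_top ENNReal.ofReal_ne_top ?_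
    rcases hαγ.eq_or_lt with rfl | hαγ
    · simp
    · obtain ⟨n, hn⟩ := exists_nat_gt ((γ - α) / α)
      refine lintegral_exp_log_ne_top hα hαγ hLevy hHit hη h1 n (γ - α)
        (sub_nonneg.2 hαγ.le) (by linarith) ?_
      have := (div_lt_iff₀ hα).1 hn
      linarith
end
end

section
/- The Lamperti–Jacobsen–Yor transformation produces a multi-self-similar family: with ξ an ℝ^n-valued Lévy process possibly killed at an independent exponential time ζ of rate q≥0 (cemetery Δ), and X^{(x)} defined by the Lamperti–Jacobsen–Yor transform with absorption in the set {u∈[0,∞)^n : ∏ u_i = 0} at time p_αb(x)·∫_0^ζ e^{⟨αb,ξ_s⟩}ds, the Markov family (X,(P_x))_{x∈[0,∞)^n} satisfies the 1/αb-multi-self-similarity property: for all scaling factors c_1,…,c_n>0 and all x∈ℝ_+^n, the law of ((c_1 X^1_{t/c},…,c_n X^n_{t/c}))_{t≥0} under P_x equals the law of X under P_{(c_1x_1,…,c_nx_n)}, where c=∏_{i=1}^n c_i^{α_i}. -/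
open MeasureTheory Real Set Filter
open scoped ENNReal Classical

noncomputable section

variable {Ω : Type*} {n : ℕ}

/-- `p_α(u) = ∏ u_i^{α_i}`. -/
def pAlpha (αb : Fin n → ℝ) (u : Fin n → ℝ) : ℝ := ∏ i, u i ^ αb i

/-- The clock `s ↦ ∫_0^s e^{⟨αb, ξ_r⟩} 1_{r<ζ} dr` of the Lamperti–Jacobsen–Yor
transformation. -/
def mClock (αb : Fin n → ℝ) (ξ : ℝ → Ω → Fin n → ℝ) (ζ : Ω → ℝ≥0∞) (ω : Ω) (s : ℝ) : ℝ≥0∞ :=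
  ∫⁻ u in Set.Ioo (0 : ℝ) s,
    {u : ℝ | ENNReal.ofReal u < ζ ω}.indicator
      (fun u => ENNReal.ofReal (Real.exp (∑ i, αb i * ξ u ω i))) u

/-- The exponential functional `∫_0^ζ e^{⟨αb, ξ_s⟩} ds`. -/
def mExpFunctional (αb : Fin n → ℝ) (ξ : ℝ → Ω → Fin n → ℝ) (ζ : Ω → ℝ≥0∞) (ω : Ω) : ℝ≥0∞ :=
  ∫⁻ u in Set.Ioi (0 : ℝ),
    {u : ℝ | ENNReal.ofReal u < ζ ω}.indicator
      (fun u => ENNReal.ofReal (Real.exp (∑ i, αb i * ξ u ω i))) u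

/-- The time change `τ(t) = inf{s > 0 : ∫_0^s e^{⟨αb, ξ_r⟩} dr > t}`. -/
def mTimeChange (αb : Fin n → ℝ) (ξ : ℝ → Ω → Fin n → ℝ) (ζ : Ω → ℝ≥0∞) (ω : Ω) (t : ℝ) : ℝ :=
  sInf {s : ℝ | 0 < s ∧ ENNReal.ofReal t < mClock αb ξ ζ ω s}

/-- The Lamperti–Jacobsen–Yor transform: `X^{(x)}_t = x ∘ exp(ξ_{τ(t/p_α(x))})` for
`t < p_α(x) ∫_0^ζ e^{⟨αb,ξ⟩}`, absorbed in the set `{u : ∏ u_i = 0}` (at the point `0`)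
afterwards, and also whenever `x` itself lies in that set. -/
def ljyPath (αb : Fin n → ℝ) (ξ : ℝ → Ω → Fin n → ℝ) (ζ : Ω → ℝ≥0∞)
    (x : Fin n → ℝ) (t : ℝ) (ω : Ω) : Fin n → ℝ :=
  if (∀ i, 0 < x i) ∧ ENNReal.ofReal (t / pAlpha αb x) < mExpFunctional αb ξ ζ ω then
    fun i => x i * Real.exp (ξ (mTimeChange αb ξ ζ ω (t / pAlpha αb x)) ω i)
  else 0

/-- `ξ` is, under `P`, an `ℝⁿ`-valued Lévy process killed at the (independent exponential)
time `ζ`: joint measurability, `ξ_0 = 0` a.s., and stationary independent increments on the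
event of survival. -/
def IsKilledLevyVec [MeasurableSpace Ω] (P : Measure Ω) (ξ : ℝ → Ω → Fin n → ℝ)
    (ζ : Ω → ℝ≥0∞) : Prop :=
  Measurable (Function.uncurry ξ) ∧ Measurable ζ ∧ (∀ᵐ ω ∂P, ξ 0 ω = 0) ∧
    ∀ s t : ℝ, 0 ≤ s → 0 ≤ t → ∀ g h : (Fin n → ℝ) → ℝ≥0∞, Measurable g → Measurable h →
      ∫⁻ ω, {ω : Ω | ENNReal.ofReal (s + t) < ζ ω}.indicator
          (fun ω => g (ξ s ω) * h (ξ (s + t) ω - ξ s ω)) ω ∂P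
        = (∫⁻ ω, {ω : Ω | ENNReal.ofReal s < ζ ω}.indicator (fun ω => g (ξ s ω)) ω ∂P)
            * ∫⁻ ω, {ω : Ω | ENNReal.ofReal t < ζ ω}.indicator (fun ω => h (ξ t ω)) ω ∂P

/-- `p_α` is multiplicative for the Hadamard product on the nonnegative orthant. -/
theorem pAlpha_mul {n : ℕ} (αb : Fin n → ℝ) {c x : Fin n → ℝ} (hc : ∀ i, 0 ≤ c i)
    (hx : ∀ i, 0 ≤ x i) :
    pAlpha αb (fun i => c i * x i) = pAlpha αb c * pAlpha αb x := by
  simp only [pAlpha, ← Finset.prod_mul_distrib]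
  exact Finset.prod_congr rfl fun i _ => Real.mul_rpow (hc i) (hx i)

/-- The Lamperti–Jacobsen–Yor transform is multi-self-similar path by path. -/
theorem ljyPath_mul {Ω : Type*} {n : ℕ} (αb : Fin n → ℝ) (ξ : ℝ → Ω → Fin n → ℝ) (ζ : Ω → ℝ≥0∞)
    {c x : Fin n → ℝ} (hc : ∀ i, 0 < c i) (hx : ∀ i, 0 ≤ x i) (t : ℝ) (ω : Ω) :
    ljyPath αb ξ ζ (fun i => c i * x i) t ω =
      fun i => c i * ljyPath αb ξ ζ x (t / pAlpha αb c) ω i := by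
  have hpos : (∀ i, 0 < c i * x i) ↔ ∀ i, 0 < x i :=
    forall_congr' fun i => mul_pos_iff_of_pos_left (hc i)
  funext i
  simp only [ljyPath, pAlpha_mul αb (fun i => (hc i).le) hx, ← div_div, hpos]
  split_ifs <;> simp [mul_assoc]

/-- The Lamperti–Jacobsen–Yor transformation produces a `1/αb`-multi-self-similar Markov
family: for all scaling factors `c_1, …, c_n > 0` and all starting points `x ∈ ℝ₊ⁿ`, the law
of `((c_i X^{(x),i}_{t/c})_i)_{t ≥ 0}` equals the law of `(X^{(c∘x)}_t)_{t ≥ 0}`, where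
`c = ∏ c_i^{α_i}`. -/
theorem ljy_multi_self_similar {Ω : Type*} [MeasurableSpace Ω] {n : ℕ}
    (P : Measure Ω) [IsProbabilityMeasure P]
    (αb : Fin n → ℝ) (ξ : ℝ → Ω → Fin n → ℝ) (ζ : Ω → ℝ≥0∞)
    (hLevy : IsKilledLevyVec P ξ ζ) :
    ∀ c : Fin n → ℝ, (∀ i, 0 < c i) → ∀ x : Fin n → ℝ, (∀ i, 0 ≤ x i) →
      Measure.map
          (fun ω => fun t : ℝ => fun i => c i * ljyPath αb ξ ζ x (t / pAlpha αb c) ω i) P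
        = Measure.map (fun ω => fun t : ℝ => ljyPath αb ξ ζ (fun i => c i * x i) t ω) P := by
  intro c hc x hx
  simp only [ljyPath_mul αb ξ ζ hc hx]
end
end
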